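/- For all dimensions d_A and d_C there exists a constant c < 1 such that for every d_B and every non-negative tripartite pure state ψ on systems A, B, C with local dimensions d_A, d_B, d_C satisfying ρ_AC = ρ_A ⊗ ρ_C, the average post-measurement entropy satisfies Σ_j P_j · S(ρ_A(j)) ≤ c · max(S(ρ_A), S(ρ_C)), where the sum runs over measurement outcomes j on B with P_j > 0. -/

import Mathlib

open scoped BigOperators Kronecker
open scoped Classical

noncomputable def rhoA {dA dB dC : ℕ} (ψ : Fin dA × Fin dB × Fin dC → ℂ) :
    Matrix (Fin dA) (Fin dA) ℂ :=
  Matrix.of fun i i' => ∑ j : Fin dB, ∑ k : Fin dC,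
    ψ (i, j, k) * (starRingEnd ℂ) (ψ (i', j, k))

noncomputable def rhoC {dA dB dC : ℕ} (ψ : Fin dA × Fin dB × Fin dC → ℂ) :
    Matrix (Fin dC) (Fin dC) ℂ :=
  Matrix.of fun k k' => ∑ i : Fin dA, ∑ j : Fin dB,
    ψ (i, j, k) * (starRingEnd ℂ) (ψ (i, j, k'))

noncomputable def rhoAC {dA dB dC : ℕ} (ψ : Fin dA × Fin dB × Fin dC → ℂ) :
    Matrix (Fin dA × Fin dC) (Fin dA × Fin dC) ℂ :=
  Matrix.of fun p q => ∑ j : Fin dB, ψ (p.1, j, p.2) * (starRingEnd ℂ) (ψ (q.1, j, q.2))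

noncomputable def probB {dA dB dC : ℕ} (ψ : Fin dA × Fin dB × Fin dC → ℂ) (j : Fin dB) : ℝ :=
  ∑ i : Fin dA, ∑ k : Fin dC, Complex.normSq (ψ (i, j, k))

noncomputable def rhoAPost {dA dB dC : ℕ} (ψ : Fin dA × Fin dB × Fin dC → ℂ) (j : Fin dB) :
    Matrix (Fin dA) (Fin dA) ℂ :=
  Matrix.of fun i i' => (probB ψ j : ℂ)⁻¹ *
    ∑ k : Fin dC, ψ (i, j, k) * (starRingEnd ℂ) (ψ (i', j, k))

def Normalized {dA dB dC : ℕ} (ψ : Fin dA × Fin dB × Fin dC → ℂ) : Prop :=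
  ∑ i : Fin dA, ∑ j : Fin dB, ∑ k : Fin dC, Complex.normSq (ψ (i, j, k)) = 1

def NonNeg {dA dB dC : ℕ} (ψ : Fin dA × Fin dB × Fin dC → ℂ) : Prop :=
  ∀ x, 0 ≤ (ψ x).re ∧ (ψ x).im = 0

noncomputable def vnEntropy {n : Type*} [Fintype n] [DecidableEq n]
    (ρ : Matrix n n ℂ) : ℝ :=
  if h : ρ.IsHermitian then -∑ a, h.eigenvalues a * Real.log (h.eigenvalues a) else 0

/-- Shannon entropy of the spectrum (with multiplicity) of a real square matrix. -/
noncomputable def specEntropy {n : Type*} [Fintype n] [DecidableEq n] (A : Matrix n n ℝ) : ℝ :=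
  (A.charpoly.roots.map Real.negMulLog).sum

section Spectral

variable {n m : Type*} [Fintype n] [DecidableEq n] [Fintype m] [DecidableEq m]

theorem specEntropy_eq_sum_eigenvalues {A : Matrix n n ℝ} (hA : A.IsHermitian) :
    specEntropy A = ∑ i, Real.negMulLog (hA.eigenvalues i) := by
  rw [specEntropy, hA.roots_charpoly_eq_eigenvalues, Multiset.map_map]
  rfl

theorem vnEntropy_map_ofReal {A : Matrix n n ℝ} (hA : A.IsHermitian) :
    vnEntropy (A.map Complex.ofRealHom) = specEntropy A := by
  have hB : (A.map Complex.ofRealHom).IsHermitian := by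
    ext i j
    have := hA.apply i j
    simp at this
    simp [this]
  have h1 := hB.roots_charpoly_eq_eigenvalues
  rw [Matrix.charpoly_map, hA.splits_charpoly.roots_map] at h1
  have h2 := congrArg (Multiset.map Complex.re) h1
  rw [Multiset.map_map, Multiset.map_map] at h2
  have h3 : A.charpoly.roots = Multiset.map hB.eigenvalues Finset.univ.val := by
    convert h2 using 1
    · exact (Multiset.map_id' _).symm
    · rfl
  rw [vnEntropy, dif_pos hB, specEntropy, h3, Multiset.map_map]
  simp [Real.negMulLog]

theorem specEntropy_mul_transpose (A : Matrix n m ℝ) :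
    specEntropy (A * A.transpose) = specEntropy (A.transpose * A) := by
  have h := congrArg Polynomial.roots (Matrix.charpoly_mul_comm' A A.transpose)
  rw [Polynomial.roots_mul, Polynomial.roots_mul, Polynomial.roots_X_pow,
    Polynomial.roots_X_pow] at h
  · have h2 := congrArg (fun s => (s.map Real.negMulLog).sum) h
    simpa [specEntropy, Multiset.map_nsmul, Multiset.sum_nsmul] using h2
  · exact ((Polynomial.monic_X_pow _).mul (Matrix.charpoly_monic _)).ne_zero
  · exact ((Polynomial.monic_X_pow _).mul (Matrix.charpoly_monic _)).ne_zero

theorem exists_spectral_decomposition {A : Matrix n n ℝ} (hA : A.PosSemidef) (ht : A.trace = 1) :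
    ∃ (U : Matrix n n ℝ) (p : n → ℝ), U.transpose * U = 1 ∧ U * U.transpose = 1 ∧
      A = U * Matrix.diagonal p * U.transpose ∧ (∀ i, 0 ≤ p i) ∧ ∑ i, p i = 1 ∧
      specEntropy A = ∑ i, Real.negMulLog (p i) := by
  have hU := hA.1.eigenvectorUnitary.2
  refine ⟨hA.1.eigenvectorUnitary, hA.1.eigenvalues, ?_, ?_, ?_, hA.eigenvalues_nonneg, ?_,
    specEntropy_eq_sum_eigenvalues hA.1⟩
  · exact (Matrix.mem_unitaryGroup_iff').1 hU
  · exact (Matrix.mem_unitaryGroup_iff).1 hU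
  · exact hA.1.spectral_theorem
  · rw [← ht, hA.1.trace_eq_sum_eigenvalues]
    rfl

theorem trace_mul_of_spectral {U V : Matrix n n ℝ} (a b : n → ℝ) :
    ((U * Matrix.diagonal a * U.transpose) * (V * Matrix.diagonal b * V.transpose)).trace =
      ∑ j, ∑ i, ((U.transpose * V) j i) ^ 2 * (b i * a j) := by
  have h : ((U * Matrix.diagonal a * U.transpose) * (V * Matrix.diagonal b * V.transpose)).trace =
      ((Matrix.diagonal a * (U.transpose * V)) *
        (Matrix.diagonal b * (U.transpose * V).transpose)).trace := by
    rw [Matrix.transpose_mul, Matrix.transpose_transpose]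
    simp only [Matrix.mul_assoc]
    rw [Matrix.trace_mul_comm U]
    simp only [Matrix.mul_assoc]
  rw [h, Matrix.trace]
  refine Finset.sum_congr rfl fun j _ => ?_
  rw [Matrix.diag_apply, Matrix.mul_apply]
  refine Finset.sum_congr rfl fun i _ => ?_
  rw [Matrix.diagonal_mul, Matrix.diagonal_mul, Matrix.transpose_apply]
  ring

end Spectral

section Scalar

theorem negMulLog_le_two_mul_sqrt {x : ℝ} (h0 : 0 ≤ x) (h1 : x ≤ 1) :
    Real.negMulLog x ≤ 2 * √(x * (1 - x)) := by
  rcases h0.eq_or_lt with rfl | h0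
  · simp
  set s := √x with hs
  have hs0 : 0 < s := Real.sqrt_pos.2 h0
  have hx : x = s ^ 2 := (Real.sq_sqrt h0.le).symm
  have hs1 : s ≤ 1 := Real.sqrt_le_one.2 h1
  have hlog : Real.log (s⁻¹) ≤ s⁻¹ - 1 := Real.log_le_sub_one_of_pos (inv_pos.2 hs0)
  rw [Real.log_inv] at hlog
  have h2 : Real.negMulLog x ≤ 2 * (s * (1 - s)) := by
    rw [Real.negMulLog, hx, Real.log_pow]
    have : s ^ 2 * (-Real.log s) ≤ s ^ 2 * (s⁻¹ - 1) :=
      mul_le_mul_of_nonneg_left hlog (sq_nonneg s)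
    have e : s ^ 2 * (s⁻¹ - 1) = s * (1 - s) := by field_simp
    push_cast
    linarith
  refine h2.trans ?_
  have : s * (1 - s) ≤ √(x * (1 - x)) := by
    apply Real.le_sqrt_of_sq_le
    rw [hx, mul_pow]
    refine mul_le_mul_of_nonneg_left ?_ (sq_nonneg s)
    nlinarith
  linarith

theorem sq_sub_div_four_le_bregman {p q : ℝ} (hp : 0 ≤ p) (hp1 : p ≤ 1) (hq : 0 < q)
    (hq1 : q ≤ 1) :
    (p - q) ^ 2 / 4 ≤
      Real.negMulLog q - Real.negMulLog p - (p - q) * (1 + Real.log q) := by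
  rcases hp.eq_or_lt with rfl | hp
  · simp only [Real.negMulLog, Real.log_zero]
    nlinarith
  set x := √p with hx
  set y := √q with hy
  have hx0 : 0 < x := Real.sqrt_pos.2 hp
  have hy0 : 0 < y := Real.sqrt_pos.2 hq
  have hpx : p = x ^ 2 := (Real.sq_sqrt hp.le).symm
  have hqy : q = y ^ 2 := (Real.sq_sqrt hq.le).symm
  have hx1 : x ≤ 1 := Real.sqrt_le_one.2 hp1
  have hy1 : y ≤ 1 := Real.sqrt_le_one.2 hq1
  have hlog : Real.log (y / x) ≤ y / x - 1 := Real.log_le_sub_one_of_pos (div_pos hy0 hx0)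
  rw [Real.log_div hy0.ne' hx0.ne'] at hlog
  have h3 := mul_le_mul_of_nonneg_left hlog (sq_nonneg x)
  have e : x ^ 2 * (y / x - 1) = x * y - x ^ 2 := by field_simp
  rw [e] at h3
  rw [hpx, hqy, Real.negMulLog, Real.negMulLog, Real.log_pow, Real.log_pow]
  push_cast
  have h4 : (x ^ 2 - y ^ 2) ^ 2 / 4 ≤ (x - y) ^ 2 := by
    have : (x + y) ^ 2 ≤ 4 := by nlinarith
    have h5 := mul_le_mul_of_nonneg_left this (sq_nonneg (x - y))
    nlinarith
  nlinarith

end Scalar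

section SpectralBounds

variable {n : Type*} [Fintype n] [DecidableEq n]

theorem trace_mul_of_spectral_same {U : Matrix n n ℝ} (hU : U.transpose * U = 1)
    (a b : n → ℝ) :
    ((U * Matrix.diagonal a * U.transpose) * (U * Matrix.diagonal b * U.transpose)).trace =
      ∑ i, a i * b i := by
  rw [trace_mul_of_spectral, hU]
  refine Finset.sum_congr rfl fun j _ => ?_
  rw [Finset.sum_eq_single j]
  · simp [mul_comm]
  · intro i _ hij
    simp [Matrix.one_apply_ne hij.symm]
  · simp

theorem trace_mul_self_of_spectral {U : Matrix n n ℝ} (hU : U.transpose * U = 1) (p : n → ℝ) :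
    ((U * Matrix.diagonal p * U.transpose) * (U * Matrix.diagonal p * U.transpose)).trace =
      ∑ i, p i ^ 2 := by
  simp only [trace_mul_of_spectral_same hU, sq]

omit [DecidableEq n] in
theorem one_sub_sum_sq_eq {p : n → ℝ} (h : ∑ i, p i = 1) :
    1 - ∑ i, p i ^ 2 = ∑ i, p i * (1 - p i) := by
  rw [← h, ← Finset.sum_sub_distrib, h]
  exact Finset.sum_congr rfl fun i _ => by ring

omit [DecidableEq n] in
theorem le_one_of_sum_eq_one {p : n → ℝ} (h0 : ∀ i, 0 ≤ p i) (h : ∑ i, p i = 1) (i : n) :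
    p i ≤ 1 :=
  h ▸ Finset.single_le_sum (fun j _ => h0 j) (Finset.mem_univ i)

theorem trace_mul_self_le_one {A : Matrix n n ℝ} (hA : A.PosSemidef) (ht : A.trace = 1) :
    (A * A).trace ≤ 1 := by
  obtain ⟨U, p, hU, -, rfl, hp0, hp1, -⟩ := exists_spectral_decomposition hA ht
  rw [trace_mul_self_of_spectral hU, ← sub_nonneg, one_sub_sum_sq_eq hp1]
  exact Finset.sum_nonneg fun i _ =>
    mul_nonneg (hp0 i) (sub_nonneg.2 (le_one_of_sum_eq_one hp0 hp1 i))

theorem specEntropy_nonneg {A : Matrix n n ℝ} (hA : A.PosSemidef) (ht : A.trace = 1) :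
    0 ≤ specEntropy A := by
  obtain ⟨U, p, -, -, -, hp0, hp1, he⟩ := exists_spectral_decomposition hA ht
  rw [he]
  exact Finset.sum_nonneg fun i _ =>
    Real.negMulLog_nonneg (hp0 i) (le_one_of_sum_eq_one hp0 hp1 i)

/-- The entropy is controlled by the square root of the linear entropy. -/
theorem specEntropy_le_sqrt {A : Matrix n n ℝ} (hA : A.PosSemidef) (ht : A.trace = 1) :
    specEntropy A ≤ 2 * Fintype.card n * √(1 - (A * A).trace) := by
  obtain ⟨U, p, hU, -, hAe, hp0, hp1, he⟩ := exists_spectral_decomposition hA ht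
  have hL : 1 - (A * A).trace = ∑ i, p i * (1 - p i) := by
    rw [hAe, trace_mul_self_of_spectral hU, one_sub_sum_sq_eq hp1]
  rw [he, hL]
  have : ∀ i ∈ (Finset.univ : Finset n),
      Real.negMulLog (p i) ≤ 2 * √(∑ i, p i * (1 - p i)) := by
    intro i _
    have hi := le_one_of_sum_eq_one hp0 hp1
    refine (negMulLog_le_two_mul_sqrt (hp0 i) (hi i)).trans ?_
    gcongr
    exact Finset.single_le_sum (f := fun i => p i * (1 - p i))
      (fun j _ => mul_nonneg (hp0 j) (sub_nonneg.2 (hi j))) (Finset.mem_univ i)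
  refine (Finset.sum_le_card_nsmul _ _ _ this).trans_eq ?_
  rw [nsmul_eq_mul, Finset.card_univ]
  ring

/-- Near pure states the entropy dominates any multiple of the linear entropy. -/
theorem mul_linear_entropy_le_specEntropy {A : Matrix n n ℝ} (hA : A.PosSemidef)
    (ht : A.trace = 1) {K : ℝ} (hK : 0 ≤ K) (hL : 1 - (A * A).trace ≤ Real.exp (-(2 * K))) :
    K * (1 - (A * A).trace) ≤ specEntropy A := by
  obtain ⟨U, p, hU, -, hAe, hp0, hp1, he⟩ := exists_spectral_decomposition hA ht
  have hi := le_one_of_sum_eq_one hp0 hp1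
  have hsq : (A * A).trace = ∑ i, p i ^ 2 := by rw [hAe, trace_mul_self_of_spectral hU]
  have hne : (Finset.univ : Finset n).Nonempty := by
    by_contra h
    rw [Finset.not_nonempty_iff_eq_empty] at h
    rw [h] at hp1
    simp at hp1
  obtain ⟨m, -, hm⟩ := Finset.exists_max_image Finset.univ p hne
  have h1 : (A * A).trace ≤ p m := by
    rw [hsq]
    calc ∑ i, p i ^ 2 ≤ ∑ i, p m * p i := Finset.sum_le_sum fun i _ => by
          rw [sq]; exact mul_le_mul_of_nonneg_right (hm i (Finset.mem_univ i)) (hp0 i)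
      _ = p m := by rw [← Finset.mul_sum, hp1, mul_one]
  have hsplit : p m + ∑ i ∈ Finset.univ.erase m, p i = 1 := by
    rw [Finset.add_sum_erase _ _ (Finset.mem_univ m), hp1]
  have hsmall : ∀ i ∈ Finset.univ.erase m, 2 * K * p i ≤ Real.negMulLog (p i) := by
    intro i hi'
    have h2 : p i ≤ ∑ i ∈ Finset.univ.erase m, p i :=
      Finset.single_le_sum (fun j _ => hp0 j) hi'
    rcases (hp0 i).eq_or_lt with h0 | h0
    · simp [← h0]
    have h3 : Real.log (p i) ≤ -(2 * K) := by
      rw [Real.log_le_iff_le_exp h0]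
      linarith
    rw [Real.negMulLog]
    nlinarith
  have hsum := Finset.sum_le_sum hsmall
  rw [← Finset.mul_sum] at hsum
  have hS : specEntropy A = Real.negMulLog (p m) +
      ∑ i ∈ Finset.univ.erase m, Real.negMulLog (p i) := by
    rw [he, Finset.add_sum_erase _ (fun i => Real.negMulLog (p i)) (Finset.mem_univ m)]
  have hm0 := Real.negMulLog_nonneg (hp0 m) (hi m)
  have hLe : 1 - (A * A).trace ≤ 2 * ∑ i ∈ Finset.univ.erase m, p i := by
    rw [hsq, one_sub_sum_sq_eq hp1, ← Finset.add_sum_erase _ _ (Finset.mem_univ m)]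
    have : ∑ i ∈ Finset.univ.erase m, p i * (1 - p i) ≤ ∑ i ∈ Finset.univ.erase m, p i :=
      Finset.sum_le_sum fun i _ => by nlinarith [hp0 i]
    nlinarith [hp0 m, hi m]
  nlinarith

end SpectralBounds

section Klein

variable {n : Type*} [Fintype n] [DecidableEq n]

/-- Klein's inequality with a quadratic remainder; `Λ` plays the role of `1 + log G`. -/
theorem exists_quantitative_klein {G : Matrix n n ℝ} (hG : G.PosSemidef) (hGt : G.trace = 1) :
    ∃ Λ : Matrix n n ℝ, ∀ ρ : Matrix n n ℝ, ρ.PosSemidef → ρ.trace = 1 →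
      (∃ w : ℝ, 0 < w ∧ (G - w • ρ).PosSemidef) →
      ((ρ - G) * (ρ - G)).trace / 4 ≤
        specEntropy G - specEntropy ρ - ((ρ - G) * Λ).trace := by
  obtain ⟨U, q, hU, hU', hGe, hq0, hq1, hSG⟩ := exists_spectral_decomposition hG hGt
  refine ⟨U * Matrix.diagonal (fun j => 1 + Real.log (q j)) * U.transpose, ?_⟩
  rintro ρ hρ hρt ⟨w, hw, hwp⟩
  obtain ⟨V, p, hV, hV', hρe, hp0, hp1, hSρ⟩ := exists_spectral_decomposition hρ hρt
  set B := U.transpose * V with hB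
  have hBB : B * B.transpose = 1 := by
    rw [hB, Matrix.transpose_mul, Matrix.transpose_transpose, Matrix.mul_assoc,
      ← Matrix.mul_assoc V, hV', Matrix.one_mul, hU]
  have hBB' : B.transpose * B = 1 := by
    rw [hB, Matrix.transpose_mul, Matrix.transpose_transpose, Matrix.mul_assoc,
      ← Matrix.mul_assoc U, hU', Matrix.one_mul, hV]
  have hrow : ∀ j, ∑ i, B j i ^ 2 = 1 := fun j => by
    have := congrFun (congrFun hBB j) j
    rw [Matrix.mul_apply, Matrix.one_apply_eq] at this
    simpa [sq] using this
  have hcol : ∀ i, ∑ j, B j i ^ 2 = 1 := fun i => by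
    have := congrFun (congrFun hBB' i) i
    rw [Matrix.mul_apply, Matrix.one_apply_eq] at this
    simpa [sq] using this
  have hq : ∀ f : n → ℝ, ∑ j, f j = ∑ j, ∑ i, B j i ^ 2 * f j := fun f => by
    simp_rw [← Finset.sum_mul, hrow, one_mul]
  have hp : ∀ f : n → ℝ, ∑ i, f i = ∑ j, ∑ i, B j i ^ 2 * f i := fun f => by
    rw [Finset.sum_comm]
    simp_rw [← Finset.sum_mul, hcol, one_mul]
  have hsupp : ∀ j i, q j = 0 → B j i ^ 2 * p i = 0 := by
    intro j i hj
    have h1 := (hwp.conjTranspose_mul_mul_same U).diag_nonneg (i := j)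
    have h2 : U.conjTranspose * (G - w • ρ) * U =
        Matrix.diagonal q - w • (B * Matrix.diagonal p * B.transpose) := by
      have e1 : U.transpose * G * U = Matrix.diagonal q := by
        rw [hGe]
        simp only [Matrix.mul_assoc]
        rw [hU, Matrix.mul_one, ← Matrix.mul_assoc, hU, Matrix.one_mul]
      have e2 : U.transpose * ρ * U = B * Matrix.diagonal p * B.transpose := by
        rw [hB, hρe, Matrix.transpose_mul, Matrix.transpose_transpose]
        simp only [Matrix.mul_assoc]
      rw [Matrix.conjTranspose_eq_transpose_of_trivial, Matrix.mul_sub, Matrix.sub_mul, e1,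
        Matrix.mul_smul, Matrix.smul_mul, e2]
    have h3 : (B * Matrix.diagonal p * B.transpose) j j = ∑ i, B j i ^ 2 * p i := by
      rw [Matrix.mul_apply]
      refine Finset.sum_congr rfl fun i _ => ?_
      rw [Matrix.mul_diagonal, Matrix.transpose_apply]
      ring
    rw [h2, Matrix.sub_apply, Matrix.diagonal_apply_eq, hj, Matrix.smul_apply, h3,
      smul_eq_mul] at h1
    have h4 : ∑ i, B j i ^ 2 * p i ≤ 0 := by nlinarith
    have h5 : B j i ^ 2 * p i ≤ ∑ i, B j i ^ 2 * p i :=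
      Finset.single_le_sum (f := fun i => B j i ^ 2 * p i)
        (fun i _ => mul_nonneg (sq_nonneg _) (hp0 i)) (Finset.mem_univ i)
    exact le_antisymm (h5.trans h4) (mul_nonneg (sq_nonneg _) (hp0 i))
  have t1 : ((ρ - G) * (ρ - G)).trace =
      ∑ j, ∑ i, B j i ^ 2 * (p i - q j) ^ 2 := by
    have e : ((ρ - G) * (ρ - G)).trace =
        (ρ * ρ).trace + (G * G).trace - 2 * (G * ρ).trace := by
      rw [Matrix.sub_mul, Matrix.mul_sub, Matrix.mul_sub, Matrix.trace_sub, Matrix.trace_sub,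
        Matrix.trace_sub, Matrix.trace_mul_comm ρ G]
      ring
    rw [e, hGe, hρe, trace_mul_self_of_spectral hU, trace_mul_self_of_spectral hV,
      trace_mul_of_spectral, ← hB, hp (fun i => p i ^ 2), hq (fun j => q j ^ 2), Finset.mul_sum,
      ← Finset.sum_add_distrib,
      ← Finset.sum_sub_distrib]
    refine Finset.sum_congr rfl fun j _ => ?_
    rw [Finset.mul_sum, ← Finset.sum_add_distrib, ← Finset.sum_sub_distrib]
    exact Finset.sum_congr rfl fun i _ => by ring
  have t2 : ((ρ - G) * (U * Matrix.diagonal (fun j => 1 + Real.log (q j)) * U.transpose)).trace =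
      ∑ j, ∑ i, B j i ^ 2 * ((p i - q j) * (1 + Real.log (q j))) := by
    rw [Matrix.sub_mul, Matrix.trace_sub, Matrix.trace_mul_comm ρ, hρe, trace_mul_of_spectral,
      ← hB, hGe, trace_mul_of_spectral_same hU,
      hq (fun j => q j * (1 + Real.log (q j))), ← Finset.sum_sub_distrib]
    refine Finset.sum_congr rfl fun j _ => ?_
    rw [← Finset.sum_sub_distrib]
    exact Finset.sum_congr rfl fun i _ => by ring
  rw [t1, t2, hSG, hSρ, hp (fun i => Real.negMulLog (p i)), hq (fun i => Real.negMulLog (q i)),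
    Finset.sum_div, ← Finset.sum_sub_distrib, ← Finset.sum_sub_distrib]
  refine Finset.sum_le_sum fun j _ => ?_
  rw [Finset.sum_div, ← Finset.sum_sub_distrib, ← Finset.sum_sub_distrib]
  refine Finset.sum_le_sum fun i _ => ?_
  rw [← mul_sub, ← mul_sub, mul_div_assoc]
  rcases (hq0 j).eq_or_lt with h0 | h0
  · rcases mul_eq_zero.1 (hsupp j i h0.symm) with h1 | h1
    · simp [h1]
    · simp [h1, ← h0]
  · exact mul_le_mul_of_nonneg_left (sq_sub_div_four_le_bregman (hp0 i)
      (le_one_of_sum_eq_one hp0 hp1 i) h0 (le_one_of_sum_eq_one hq0 hq1 j)) (sq_nonneg _)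

/-- Strong concavity of the entropy along an ensemble of states. -/
theorem sum_trace_sq_sub_le_entropy_gap {ι : Type*} [Fintype ι] {w : ι → ℝ} (hw : ∀ j, 0 < w j)
    (hw1 : ∑ j, w j = 1) {ρ : ι → Matrix n n ℝ} (hρ : ∀ j, (ρ j).PosSemidef)
    (hρt : ∀ j, (ρ j).trace = 1) {G : Matrix n n ℝ} (hG : G = ∑ j, w j • ρ j) :
    ∑ j, w j * ((ρ j - G) * (ρ j - G)).trace ≤
      4 * (specEntropy G - ∑ j, w j * specEntropy (ρ j)) := by
  classical
  have hGp : G.PosSemidef := by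
    rw [hG]
    exact Matrix.posSemidef_sum _ fun j _ => (hρ j).smul (hw j).le
  have hGt : G.trace = 1 := by
    rw [hG, Matrix.trace_sum]
    simp [Matrix.trace_smul, hρt, hw1]
  obtain ⟨Λ, hΛ⟩ := exists_quantitative_klein hGp hGt
  have h1 : ∀ j, w j * (((ρ j - G) * (ρ j - G)).trace / 4) ≤
      w j * (specEntropy G - specEntropy (ρ j) - ((ρ j - G) * Λ).trace) := by
    intro j
    refine mul_le_mul_of_nonneg_left (hΛ _ (hρ j) (hρt j) ⟨w j, hw j, ?_⟩) (hw j).le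
    rw [hG, ← Finset.add_sum_erase _ _ (Finset.mem_univ j), add_sub_cancel_left]
    exact Matrix.posSemidef_sum _ fun j _ => (hρ j).smul (hw j).le
  have h2 := Finset.sum_le_sum fun j (_ : j ∈ Finset.univ) => h1 j
  have h3 : ∑ j, w j * ((ρ j - G) * Λ).trace = 0 := by
    have : ∑ j, w j * ((ρ j - G) * Λ).trace = ((∑ j, w j • (ρ j - G)) * Λ).trace := by
      rw [Finset.sum_mul, Matrix.trace_sum]
      simp [Matrix.trace_smul]
    rw [this]
    simp only [smul_sub, Finset.sum_sub_distrib, ← hG, ← Finset.sum_smul, hw1]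
    simp
  have h4 : ∑ j, w j * (specEntropy G - specEntropy (ρ j) - ((ρ j - G) * Λ).trace) =
      specEntropy G - ∑ j, w j * specEntropy (ρ j) := by
    simp only [mul_sub, Finset.sum_sub_distrib, h3, ← Finset.sum_mul, hw1]
    ring
  rw [h4] at h2
  have h5 : ∑ j, w j * (((ρ j - G) * (ρ j - G)).trace / 4) =
      (∑ j, w j * ((ρ j - G) * (ρ j - G)).trace) / 4 := by
    rw [Finset.sum_div]
    exact Finset.sum_congr rfl fun j _ => by ring
  linarith

end Klein

section Concurrence

variable {m n : Type*} [Fintype m] [Fintype n]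

theorem sum_sum_minor_sq (a b : n → ℝ) :
    ∑ k, ∑ l, (a k * b l - a l * b k) ^ 2 =
      2 * ((∑ k, a k * a k) * (∑ k, b k * b k)) - 2 * (∑ k, a k * b k) ^ 2 := by
  have h : ∀ k l, (a k * b l - a l * b k) ^ 2 =
      (a k * a k) * (b l * b l) + (b k * b k) * (a l * a l) - 2 * ((a k * b k) * (a l * b l)) :=
    fun k l => by ring
  simp only [h, Finset.sum_sub_distrib, Finset.sum_add_distrib, ← Finset.mul_sum,
    ← Finset.sum_mul]
  ring

theorem linear_entropy_eq_sum_minors {M : Matrix m n ℝ} (hM : (M * M.transpose).trace = 1) :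
    1 - ((M * M.transpose) * (M * M.transpose)).trace =
      (∑ i, ∑ i', ∑ k, ∑ l, (M i k * M i' l - M i l * M i' k) ^ 2) / 2 := by
  simp only [sum_sum_minor_sq]
  have h1 : ∀ i i', (M * M.transpose) i i' = ∑ k, M i k * M i' k := fun i i' => by
    simp [Matrix.mul_apply]
  have h2 : ((M * M.transpose) * (M * M.transpose)).trace =
      ∑ i, ∑ i', (∑ k, M i k * M i' k) ^ 2 := by
    rw [Matrix.trace]
    refine Finset.sum_congr rfl fun i _ => ?_
    rw [Matrix.diag_apply, Matrix.mul_apply]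
    refine Finset.sum_congr rfl fun i' _ => ?_
    rw [h1, h1, sq]
    simp only [mul_comm]
  have h3 : ∑ i, ∑ k, M i k * M i k = 1 := by
    rw [← hM, Matrix.trace]
    exact Finset.sum_congr rfl fun i _ => (h1 i i).symm
  rw [h2]
  simp only [Finset.sum_sub_distrib, ← Finset.mul_sum, ← Finset.sum_mul, h3]
  ring

theorem sqrt_linear_entropy_le [DecidableEq m] [DecidableEq n] {M : Matrix m n ℝ}
    (hM : (M * M.transpose).trace = 1) :
    √(1 - ((M * M.transpose) * (M * M.transpose)).trace) ≤
      2 * ∑ i, ∑ i', ∑ k, ∑ l, if i ≠ i' ∧ k ≠ l then |M i k| * |M i' l| else 0 := by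
  set x : m × m × n × n → ℝ := fun s =>
    M s.1 s.2.2.1 * M s.2.1 s.2.2.2 - M s.1 s.2.2.2 * M s.2.1 s.2.2.1 with hx
  have h1 : 1 - ((M * M.transpose) * (M * M.transpose)).trace = (∑ s, |x s| ^ 2) / 2 := by
    rw [linear_entropy_eq_sum_minors hM]
    simp [hx, Fintype.sum_prod_type, sq_abs]
  have h2 : ∑ s, |x s| ^ 2 ≤ (∑ s, |x s|) ^ 2 :=
    Finset.sum_sq_le_sq_sum_of_nonneg fun s _ => abs_nonneg _
  have h0 : 0 ≤ ∑ s, |x s| := Finset.sum_nonneg fun s _ => abs_nonneg _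
  have h3 : √(1 - ((M * M.transpose) * (M * M.transpose)).trace) ≤ ∑ s, |x s| := by
    rw [h1]
    refine Real.sqrt_le_iff.2 ⟨h0, ?_⟩
    nlinarith [Finset.sum_nonneg fun s (_ : s ∈ Finset.univ) => sq_nonneg |x s|]
  refine h3.trans ?_
  have h4 : ∀ i i', ∑ k, ∑ l, |x (i, i', k, l)| ≤
      2 * ∑ k, ∑ l, if i ≠ i' ∧ k ≠ l then |M i k| * |M i' l| else 0 := by
    intro i i'
    have h5 : ∀ k l, |x (i, i', k, l)| ≤
        (if i ≠ i' ∧ k ≠ l then |M i k| * |M i' l| else 0) +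
          (if i ≠ i' ∧ l ≠ k then |M i l| * |M i' k| else 0) := by
      intro k l
      by_cases hi : i = i'
      · subst hi
        simp [hx, mul_comm]
      by_cases hk : k = l
      · subst hk
        simp [hx]
      rw [if_pos ⟨hi, hk⟩, if_pos ⟨hi, Ne.symm hk⟩, ← abs_mul, ← abs_mul]
      exact abs_sub _ _
    calc ∑ k, ∑ l, |x (i, i', k, l)|
        ≤ ∑ k, ∑ l, ((if i ≠ i' ∧ k ≠ l then |M i k| * |M i' l| else 0) +
          (if i ≠ i' ∧ l ≠ k then |M i l| * |M i' k| else 0)) :=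
          Finset.sum_le_sum fun k _ => Finset.sum_le_sum fun l _ => h5 k l
      _ = _ := by
          simp only [Finset.sum_add_distrib]
          rw [Finset.sum_comm (f := fun k l =>
            if i ≠ i' ∧ l ≠ k then |M i l| * |M i' k| else 0)]
          ring
  rw [Fintype.sum_prod_type]
  simp only [Fintype.sum_prod_type]
  rw [Finset.mul_sum]
  refine Finset.sum_le_sum fun i _ => ?_
  rw [Finset.mul_sum]
  exact Finset.sum_le_sum fun i' _ => h4 i i'

end Concurrence

/-- Average of the left reduced states `M j * (M j)ᵀ` with weights `w`. -/
noncomputable def leftMarginal {ι m n : Type*} [Fintype ι] [Fintype n] (w : ι → ℝ)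
    (M : ι → Matrix m n ℝ) : Matrix m m ℝ :=
  ∑ j, w j • (M j * (M j).transpose)

/-- A finite ensemble of normalized real bipartite pure states, given by coefficient matrices
`M j` with weights `w j > 0`, whose average density matrix is the product of its marginals. -/
structure IsProductEnsemble {ι m n : Type*} [Fintype ι] [Fintype m] [Fintype n] (w : ι → ℝ)
    (M : ι → Matrix m n ℝ) : Prop where
  pos : ∀ j, 0 < w j
  sum_eq_one : ∑ j, w j = 1
  trace_eq_one : ∀ j, (M j * (M j).transpose).trace = 1
  average_eq : ∀ i i' k k', ∑ j, w j * (M j i k * M j i' k') =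
    leftMarginal w M i i' * leftMarginal w (fun j => (M j).transpose) k k'

namespace IsProductEnsemble

variable {ι m n : Type*} [Fintype ι] [Fintype m] [Fintype n] {w : ι → ℝ}
  {M : ι → Matrix m n ℝ}

theorem transpose (h : IsProductEnsemble w M) :
    IsProductEnsemble w (fun j => (M j).transpose) where
  pos := h.pos
  sum_eq_one := h.sum_eq_one
  trace_eq_one j := by
    rw [Matrix.transpose_transpose, Matrix.trace_mul_comm]
    exact h.trace_eq_one j
  average_eq i i' k k' := by
    have := h.average_eq k k' i i'
    simp only [Matrix.transpose_transpose, Matrix.transpose_apply]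
    rw [this, mul_comm]

theorem posSemidef_mul_transpose (A : Matrix m n ℝ) : (A * A.transpose).PosSemidef := by
  rw [← Matrix.conjTranspose_eq_transpose_of_trivial]
  exact Matrix.posSemidef_self_mul_conjTranspose A

theorem posSemidef_leftMarginal (h : IsProductEnsemble w M) : (leftMarginal w M).PosSemidef :=
  Matrix.posSemidef_sum _ fun j _ => (posSemidef_mul_transpose (M j)).smul (h.pos j).le

theorem trace_leftMarginal (h : IsProductEnsemble w M) : (leftMarginal w M).trace = 1 := by
  rw [leftMarginal, Matrix.trace_sum]
  simp [Matrix.trace_smul, h.trace_eq_one, h.sum_eq_one]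

theorem sum_bilin_mul_bilin (h : IsProductEnsemble w M) (x x' : m → ℝ) (y y' : n → ℝ) :
    ∑ j, w j * ((x ⬝ᵥ (M j).mulVec y) * (x' ⬝ᵥ (M j).mulVec y')) =
      (x ⬝ᵥ (leftMarginal w M).mulVec x') *
        (y ⬝ᵥ (leftMarginal w (fun j => (M j).transpose)).mulVec y') := by
  have e : ∀ (x : m → ℝ) (y : n → ℝ) j,
      x ⬝ᵥ (M j).mulVec y = ∑ s : m × n, x s.1 * y s.2 * M j s.1 s.2 := by
    intro x y j
    simp only [dotProduct, Matrix.mulVec, Fintype.sum_prod_type, Finset.mul_sum]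
    exact Finset.sum_congr rfl fun i _ => Finset.sum_congr rfl fun k _ => by ring
  calc ∑ j, w j * ((x ⬝ᵥ (M j).mulVec y) * (x' ⬝ᵥ (M j).mulVec y'))
      = ∑ s : m × n, ∑ t : m × n, x s.1 * y s.2 * (x' t.1 * y' t.2) *
          ∑ j, w j * (M j s.1 s.2 * M j t.1 t.2) := by
        simp only [e, Finset.sum_mul_sum]
        simp only [Finset.mul_sum]
        rw [Finset.sum_comm]
        refine Finset.sum_congr rfl fun s _ => ?_
        rw [Finset.sum_comm]
        exact Finset.sum_congr rfl fun t _ => Finset.sum_congr rfl fun j _ => by ring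
    _ = _ := by
        simp only [h.average_eq, dotProduct, Matrix.mulVec, Fintype.sum_prod_type]
        rw [Finset.sum_mul_sum]
        refine Finset.sum_congr rfl fun i _ => Finset.sum_congr rfl fun k _ => ?_
        rw [mul_mul_mul_comm, Finset.sum_mul_sum, Finset.mul_sum]
        refine Finset.sum_congr rfl fun i' _ => ?_
        rw [Finset.mul_sum]
        exact Finset.sum_congr rfl fun k' _ => by ring

end IsProductEnsemble

theorem conj_apply_eq_bilin {m n : Type*} [Fintype m] [Fintype n] (U : Matrix m m ℝ)
    (A : Matrix m n ℝ) (V : Matrix n n ℝ) (i : m) (k : n) :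
    (U.transpose * A * V) i k = (fun a => U a i) ⬝ᵥ A.mulVec (fun b => V b k) := by
  rw [Matrix.mul_assoc]
  rfl

theorem conj_diagonal_of_orthogonal {n : Type*} [Fintype n] [DecidableEq n] {U : Matrix n n ℝ}
    (hU : U.transpose * U = 1) (p : n → ℝ) :
    U.transpose * (U * Matrix.diagonal p * U.transpose) * U = Matrix.diagonal p := by
  simp only [Matrix.mul_assoc]
  rw [hU, Matrix.mul_one, ← Matrix.mul_assoc, hU, Matrix.one_mul]

theorem mul_le_linear_entropy_of_ne {n : Type*} [Fintype n] {p : n → ℝ}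
    (h0 : ∀ i, 0 ≤ p i) (h1 : ∑ i, p i = 1) {i i' : n} (hi : i ≠ i') :
    p i * p i' ≤ 1 - ∑ i, p i ^ 2 := by
  classical
  rw [one_sub_sum_sq_eq h1]
  have h2 : p i * (1 - p i) ≤ ∑ i, p i * (1 - p i) :=
    Finset.single_le_sum (f := fun i => p i * (1 - p i))
      (fun j _ => mul_nonneg (h0 j) (sub_nonneg.2 (le_one_of_sum_eq_one h0 h1 j)))
      (Finset.mem_univ i)
  have h3 : p i + p i' ≤ 1 := by
    rw [← h1, ← Finset.sum_pair hi]
    exact Finset.sum_le_sum_of_subset_of_nonneg (Finset.subset_univ _) fun j _ _ => h0 j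
  nlinarith [h0 i]

namespace IsProductEnsemble

variable {ι m n : Type*} [Fintype ι] [Fintype m] [Fintype n] [DecidableEq m] [DecidableEq n]
  {w : ι → ℝ} {M : ι → Matrix m n ℝ}

theorem sum_sqrt_linear_entropy_le (h : IsProductEnsemble w M) :
    ∑ j, w j * √(1 - ((M j * (M j).transpose) * (M j * (M j).transpose)).trace) ≤
      2 * (Fintype.card m ^ 2 * Fintype.card n ^ 2) *
        (√(1 - (leftMarginal w M * leftMarginal w M).trace) *
          √(1 - (leftMarginal w (fun j => (M j).transpose) *
            leftMarginal w (fun j => (M j).transpose)).trace)) := by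
  obtain ⟨U, p, hU, hU', hG, hp0, hp1, -⟩ :=
    exists_spectral_decomposition h.posSemidef_leftMarginal h.trace_leftMarginal
  obtain ⟨V, q, hV, hV', hH, hq0, hq1, -⟩ :=
    exists_spectral_decomposition h.transpose.posSemidef_leftMarginal
      h.transpose.trace_leftMarginal
  set N : ι → Matrix m n ℝ := fun j => U.transpose * M j * V with hN
  have hNN : ∀ j, N j * (N j).transpose = U.transpose * (M j * (M j).transpose) * U := by
    intro j
    simp only [hN, Matrix.transpose_mul, Matrix.transpose_transpose, Matrix.mul_assoc]
    rw [← Matrix.mul_assoc V, hV', Matrix.one_mul]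
  have hN1 : ∀ j, (N j * (N j).transpose).trace = 1 := by
    intro j
    rw [hNN, Matrix.trace_mul_comm, ← Matrix.mul_assoc, hU', Matrix.one_mul]
    exact h.trace_eq_one j
  have hN2 : ∀ j, ((M j * (M j).transpose) * (M j * (M j).transpose)).trace =
      ((N j * (N j).transpose) * (N j * (N j).transpose)).trace := by
    intro j
    have : U.transpose * (M j * (M j).transpose) * U * (U.transpose * (M j * (M j).transpose) * U)
        = U.transpose * ((M j * (M j).transpose) * (M j * (M j).transpose)) * U := by
      simp only [Matrix.mul_assoc]
      rw [← Matrix.mul_assoc U U.transpose, hU', Matrix.one_mul]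
    rw [hNN, this, Matrix.trace_mul_comm _ U, ← Matrix.mul_assoc U, hU',
      Matrix.one_mul]
  have hsq : ∀ i k, ∑ j, w j * N j i k ^ 2 = p i * q k := by
    intro i k
    have h1 := h.sum_bilin_mul_bilin (fun a => U a i) (fun a => U a i) (fun b => V b k)
      (fun b => V b k)
    rw [← conj_apply_eq_bilin, ← conj_apply_eq_bilin, hG, hH, conj_diagonal_of_orthogonal hU,
      conj_diagonal_of_orthogonal hV] at h1
    simp only [← conj_apply_eq_bilin, Matrix.diagonal_apply_eq] at h1
    simpa only [sq] using h1
  have hLG : 1 - (leftMarginal w M * leftMarginal w M).trace = 1 - ∑ i, p i ^ 2 := by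
    rw [hG, trace_mul_self_of_spectral hU]
  have hLH : 1 - (leftMarginal w (fun j => (M j).transpose) *
      leftMarginal w (fun j => (M j).transpose)).trace = 1 - ∑ i, q i ^ 2 := by
    rw [hH, trace_mul_self_of_spectral hV]
  rw [hLG, hLH]
  set R := √(1 - ∑ i, p i ^ 2) * √(1 - ∑ i, q i ^ 2) with hR
  have hR0 : 0 ≤ R := by positivity
  have hterm : ∀ i i' k l,
      ∑ j, w j * (if i ≠ i' ∧ k ≠ l then |N j i k| * |N j i' l| else 0) ≤ R := by
    intro i i' k l
    split_ifs with hc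
    · have h1 := Real.sum_mul_le_sqrt_mul_sqrt Finset.univ
        (fun j => √(w j) * |N j i k|) (fun j => √(w j) * |N j i' l|)
      have e1 : ∀ i k, ∑ j, (√(w j) * |N j i k|) ^ 2 = p i * q k := by
        intro i k
        rw [← hsq]
        refine Finset.sum_congr rfl fun j _ => ?_
        rw [mul_pow, Real.sq_sqrt (h.pos j).le, sq_abs]
      have e2 : ∑ j, √(w j) * |N j i k| * (√(w j) * |N j i' l|) =
          ∑ j, w j * (|N j i k| * |N j i' l|) := by
        refine Finset.sum_congr rfl fun j _ => ?_
        rw [mul_mul_mul_comm, Real.mul_self_sqrt (h.pos j).le]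
      rw [e1, e1, e2, ← Real.sqrt_mul (mul_nonneg (hp0 i) (hq0 k))] at h1
      refine h1.trans ?_
      have hA := mul_le_linear_entropy_of_ne hp0 hp1 hc.1
      have hC := mul_le_linear_entropy_of_ne hq0 hq1 hc.2
      rw [hR, ← Real.sqrt_mul ((mul_nonneg (hp0 i) (hp0 i')).trans hA)]
      apply Real.sqrt_le_sqrt
      calc p i * q k * (p i' * q l) = (p i * p i') * (q k * q l) := by ring
        _ ≤ _ := mul_le_mul hA hC (mul_nonneg (hq0 k) (hq0 l))
            ((mul_nonneg (hp0 i) (hp0 i')).trans hA)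
    · simpa using hR0
  calc ∑ j, w j * √(1 - ((M j * (M j).transpose) * (M j * (M j).transpose)).trace)
      ≤ ∑ j, w j * (2 * ∑ i, ∑ i', ∑ k, ∑ l,
          if i ≠ i' ∧ k ≠ l then |N j i k| * |N j i' l| else 0) := by
        refine Finset.sum_le_sum fun j _ => mul_le_mul_of_nonneg_left ?_ (h.pos j).le
        rw [hN2]
        exact sqrt_linear_entropy_le (hN1 j)
    _ = 2 * ∑ i, ∑ i', ∑ k, ∑ l, ∑ j, w j *
          (if i ≠ i' ∧ k ≠ l then |N j i k| * |N j i' l| else 0) := by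
        simp only [Finset.mul_sum]
        rw [Finset.sum_comm]
        refine Finset.sum_congr rfl fun i _ => ?_
        rw [Finset.sum_comm]
        refine Finset.sum_congr rfl fun i' _ => ?_
        rw [Finset.sum_comm]
        refine Finset.sum_congr rfl fun k _ => ?_
        rw [Finset.sum_comm]
        exact Finset.sum_congr rfl fun l _ => Finset.sum_congr rfl fun j _ => by ring
    _ ≤ 2 * ∑ i : m, ∑ i' : m, ∑ k : n, ∑ l : n, R := by
        gcongr
        exact hterm _ _ _ _
    _ = _ := by
        simp only [Finset.sum_const, Finset.card_univ, nsmul_eq_mul]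
        ring

/-- The average entropy is controlled by the linear entropies of the two marginals. -/
theorem sum_entropy_le (h : IsProductEnsemble w M) :
    ∑ j, w j * specEntropy (M j * (M j).transpose) ≤
      4 * (Fintype.card m ^ 3 * Fintype.card n ^ 2) *
        (√(1 - (leftMarginal w M * leftMarginal w M).trace) *
          √(1 - (leftMarginal w (fun j => (M j).transpose) *
            leftMarginal w (fun j => (M j).transpose)).trace)) := by
  calc ∑ j, w j * specEntropy (M j * (M j).transpose)
      ≤ ∑ j, w j * (2 * Fintype.card m *
          √(1 - ((M j * (M j).transpose) * (M j * (M j).transpose)).trace)) :=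
        Finset.sum_le_sum fun j _ => mul_le_mul_of_nonneg_left
          (specEntropy_le_sqrt (posSemidef_mul_transpose _) (h.trace_eq_one j)) (h.pos j).le
    _ = 2 * Fintype.card m *
          ∑ j, w j * √(1 - ((M j * (M j).transpose) * (M j * (M j).transpose)).trace) := by
        rw [Finset.mul_sum]
        exact Finset.sum_congr rfl fun j _ => by ring
    _ ≤ 2 * Fintype.card m * _ :=
        mul_le_mul_of_nonneg_left h.sum_sqrt_linear_entropy_le (by positivity)
    _ = _ := by ring

end IsProductEnsemble

section Frobenius

open scoped Matrix.Norms.Frobenius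

variable {m n : Type*} [Fintype m] [Fintype n]

theorem frobenius_norm_sq_eq_trace (A : Matrix m n ℝ) : ‖A‖ ^ 2 = (A * A.transpose).trace := by
  rw [Matrix.frobenius_norm_def, ← Real.sqrt_eq_rpow, Real.sq_sqrt (by positivity), Matrix.trace]
  refine Finset.sum_congr rfl fun i _ => ?_
  rw [Matrix.diag_apply, Matrix.mul_apply]
  refine Finset.sum_congr rfl fun k _ => ?_
  simp [sq]

theorem frobenius_norm_sq_eq_sum (A : Matrix m n ℝ) : ‖A‖ ^ 2 = ∑ i, ∑ k, A i k ^ 2 := by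
  rw [frobenius_norm_sq_eq_trace, Matrix.trace]
  refine Finset.sum_congr rfl fun i _ => ?_
  rw [Matrix.diag_apply, Matrix.mul_apply]
  exact Finset.sum_congr rfl fun k _ => by rw [Matrix.transpose_apply, sq]

theorem abs_apply_le_frobenius_norm (A : Matrix m n ℝ) (i : m) (k : n) : |A i k| ≤ ‖A‖ := by
  apply abs_le_of_sq_le_sq _ (norm_nonneg _)
  rw [frobenius_norm_sq_eq_sum]
  calc A i k ^ 2 ≤ ∑ k, A i k ^ 2 :=
        Finset.single_le_sum (f := fun k => A i k ^ 2) (fun k _ => sq_nonneg _)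
          (Finset.mem_univ k)
    _ ≤ _ := Finset.single_le_sum (f := fun i => ∑ k, A i k ^ 2)
          (fun i _ => Finset.sum_nonneg fun k _ => sq_nonneg _) (Finset.mem_univ i)

theorem abs_trace_mul_le_frobenius (A : Matrix m n ℝ) (B : Matrix n m ℝ) :
    |(A * B).trace| ≤ ‖A‖ * ‖B‖ := by
  apply abs_le_of_sq_le_sq _ (by positivity)
  rw [mul_pow, ← Matrix.frobenius_norm_transpose B, frobenius_norm_sq_eq_sum,
    frobenius_norm_sq_eq_sum]
  have := Finset.sum_mul_sq_le_sq_mul_sq Finset.univ (fun s : m × n => A s.1 s.2)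
    (fun s : m × n => B.transpose s.1 s.2)
  simpa [Fintype.sum_prod_type, Matrix.trace, Matrix.mul_apply] using this

theorem trace_sq_sub_trace_sq_le {G ρ : Matrix m m ℝ} (hG : ‖G‖ ≤ 1) (hρ : ‖ρ‖ ≤ 1) :
    |(ρ * ρ).trace - (G * G).trace| ≤ 2 * ‖ρ - G‖ := by
  have e : (ρ * ρ).trace - (G * G).trace = ((ρ - G) * (ρ + G)).trace := by
    rw [Matrix.sub_mul, Matrix.mul_add, Matrix.mul_add, Matrix.trace_sub, Matrix.trace_add,
      Matrix.trace_add, Matrix.trace_mul_comm G ρ]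
    ring
  rw [e]
  refine (abs_trace_mul_le_frobenius _ _).trans ?_
  have := norm_add_le ρ G
  nlinarith [norm_nonneg (ρ - G)]

theorem frobenius_norm_mul_le_one {a b c : Type*} [Fintype a] [Fintype b] [Fintype c]
    {A : Matrix a b ℝ} {B : Matrix b c ℝ} (hA : ‖A‖ ≤ 1) (hB : ‖B‖ ≤ 1) : ‖A * B‖ ≤ 1 :=
  (Matrix.frobenius_norm_mul A B).trans (mul_le_one₀ hA (norm_nonneg _) hB)

theorem trace_cube_sub_trace_cube (ρ G : Matrix m m ℝ) :
    (ρ * ρ * ρ).trace - (G * G * G).trace =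
      ((ρ - G) * (ρ * ρ + ρ * G + G * G)).trace := by
  have c1 : (G * ρ * ρ).trace = (ρ * ρ * G).trace := by
    rw [Matrix.mul_assoc, Matrix.trace_mul_comm]
  have c2 : (G * ρ * G).trace = (ρ * G * G).trace := by
    rw [Matrix.mul_assoc, Matrix.trace_mul_comm]
  simp only [Matrix.sub_mul, Matrix.mul_add, Matrix.trace_sub, Matrix.trace_add,
    ← Matrix.mul_assoc]
  linarith

theorem trace_cube_sub_trace_cube_le {G ρ : Matrix m m ℝ} (hG : ‖G‖ ≤ 1) (hρ : ‖ρ‖ ≤ 1) :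
    |(ρ * ρ * ρ).trace - (G * G * G).trace| ≤ ‖ρ - G‖ * 3 := by
  rw [trace_cube_sub_trace_cube]
  refine (abs_trace_mul_le_frobenius _ _).trans
    (mul_le_mul_of_nonneg_left ?_ (norm_nonneg _))
  have h1 := norm_add₃_le (a := ρ * ρ) (b := ρ * G) (c := G * G)
  linarith [frobenius_norm_mul_le_one hρ hρ, frobenius_norm_mul_le_one hρ hG,
    frobenius_norm_mul_le_one hG hG]

theorem trace_conj_mul_sub_le {G ρ : Matrix m m ℝ} {H σ : Matrix n n ℝ} {M : Matrix m n ℝ}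
    (hρ : ‖ρ‖ ≤ 1) (hH : ‖H‖ ≤ 1) (hM : ‖M‖ ≤ 1) :
    (M.transpose * ρ * M * σ).trace ≤
      (M.transpose * G * M * H).trace + ‖ρ - G‖ + ‖σ - H‖ := by
  have hMt : ‖M.transpose‖ ≤ 1 := by rwa [Matrix.frobenius_norm_transpose]
  have e : (M.transpose * ρ * M * σ).trace =
      (M.transpose * G * M * H).trace + ((ρ - G) * (M * H * M.transpose)).trace +
        ((M.transpose * ρ * M) * (σ - H)).trace := by
    have c : ((ρ - G) * (M * H * M.transpose)).trace =
        (M.transpose * ρ * M * H).trace - (M.transpose * G * M * H).trace := by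
      rw [← Matrix.mul_assoc, Matrix.trace_mul_comm, Matrix.sub_mul, Matrix.mul_sub,
        Matrix.trace_sub]
      simp only [Matrix.mul_assoc]
    rw [c, Matrix.mul_sub, Matrix.trace_sub]
    ring
  have b2 := (abs_trace_mul_le_frobenius (ρ - G) (M * H * M.transpose)).trans
      (mul_le_of_le_one_right (norm_nonneg _)
        (frobenius_norm_mul_le_one (frobenius_norm_mul_le_one hM hH) hMt))
  have b3 := (abs_trace_mul_le_frobenius (M.transpose * ρ * M) (σ - H)).trans
      (mul_le_of_le_one_left (norm_nonneg _)
        (frobenius_norm_mul_le_one (frobenius_norm_mul_le_one hMt hρ) hM))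
  rw [abs_le] at b2 b3
  linarith

theorem trace_cube_le {G : Matrix m m ℝ} {H : Matrix n n ℝ} {M : Matrix m n ℝ} (hG : ‖G‖ ≤ 1)
    (hH : ‖H‖ ≤ 1) (hM : ‖M‖ ≤ 1) :
    (G * G * G).trace ≤ (M.transpose * G * M * H).trace +
      4 * ‖M * M.transpose - G‖ + ‖M.transpose * M - H‖ := by
  have hMt : ‖M.transpose‖ ≤ 1 := by rwa [Matrix.frobenius_norm_transpose]
  have hρ := frobenius_norm_mul_le_one hM hMt
  have e : (M * M.transpose * (M * M.transpose) * (M * M.transpose)).trace =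
      (M.transpose * (M * M.transpose) * M * (M.transpose * M)).trace := by
    simp only [Matrix.mul_assoc]
    rw [Matrix.trace_mul_comm]
    simp only [Matrix.mul_assoc]
  have b1 := trace_cube_sub_trace_cube_le hG hρ
  have b2 := trace_conj_mul_sub_le (G := G) (σ := M.transpose * M) hρ hH hM
  rw [abs_le] at b1
  linarith

theorem weighted_sum_le_of_weighted_sum_sq_le {ι : Type*} [Fintype ι] {w x : ι → ℝ}
    (hw : ∀ j, 0 ≤ w j) (hw1 : ∑ j, w j = 1) {κ : ℝ} (hκ : 0 < κ)
    (h : ∑ j, w j * x j ^ 2 ≤ κ ^ 2) : ∑ j, w j * x j ≤ κ := by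
  have h1 : ∑ j, w j * (2 * κ * x j) ≤ ∑ j, w j * (κ ^ 2 + x j ^ 2) :=
    Finset.sum_le_sum fun j _ =>
      mul_le_mul_of_nonneg_left (by nlinarith [sq_nonneg (κ - x j)]) (hw j)
  have h2 : ∑ j, w j * (κ ^ 2 + x j ^ 2) = κ ^ 2 + ∑ j, w j * x j ^ 2 := by
    simp only [mul_add, Finset.sum_add_distrib, ← Finset.sum_mul, hw1, one_mul]
  have h3 : ∑ j, w j * (2 * κ * x j) = 2 * κ * ∑ j, w j * x j := by
    rw [Finset.mul_sum]
    exact Finset.sum_congr rfl fun j _ => by ring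
  rw [h2, h3] at h1
  have h4 : κ * ∑ j, w j * x j ≤ κ * κ := by nlinarith
  exact le_of_mul_le_mul_left h4 hκ

namespace IsProductEnsemble

variable {ι : Type*} [Fintype ι] {w : ι → ℝ} {M : ι → Matrix m n ℝ}

theorem norm_eq_one (h : IsProductEnsemble w M) (j : ι) : ‖M j‖ = 1 := by
  have := frobenius_norm_sq_eq_trace (M j)
  rw [h.trace_eq_one] at this
  exact (pow_eq_one_iff_of_nonneg (norm_nonneg _) two_ne_zero).1 this

theorem norm_mul_transpose_le_one (h : IsProductEnsemble w M) (j : ι) :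
    ‖M j * (M j).transpose‖ ≤ 1 := by
  refine (Matrix.frobenius_norm_mul _ _).trans ?_
  rw [Matrix.frobenius_norm_transpose, h.norm_eq_one, one_mul]

theorem norm_leftMarginal_le_one (h : IsProductEnsemble w M) : ‖leftMarginal w M‖ ≤ 1 := by
  rw [leftMarginal, ← h.sum_eq_one]
  refine (norm_sum_le _ _).trans (Finset.sum_le_sum fun j _ => ?_)
  rw [norm_smul, Real.norm_eq_abs, abs_of_pos (h.pos j)]
  exact mul_le_of_le_one_right (h.pos j).le (h.norm_mul_transpose_le_one j)

omit [Fintype m] in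
theorem transpose_leftMarginal (w : ι → ℝ) (M : ι → Matrix m n ℝ) :
    (leftMarginal w M).transpose = leftMarginal w M := by
  simp [leftMarginal, Matrix.transpose_sum, Matrix.transpose_smul, Matrix.transpose_mul]

theorem sum_trace_eq (h : IsProductEnsemble w M) :
    ∑ j, w j * ((M j).transpose * leftMarginal w M * M j *
        leftMarginal w (fun j => (M j).transpose)).trace =
      (leftMarginal w M * leftMarginal w M).trace *
        (leftMarginal w (fun j => (M j).transpose) *
          leftMarginal w (fun j => (M j).transpose)).trace := by
  set G := leftMarginal w M with hG
  set H := leftMarginal w (fun j => (M j).transpose) with hH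
  have e : ∀ A : Matrix m n ℝ, (A.transpose * G * A * H).trace =
      ∑ i, ∑ k, ∑ i', ∑ k', G i i' * H k' k * (A i k * A i' k') := by
    intro A
    rw [Matrix.mul_assoc, Matrix.mul_assoc, Matrix.trace, Finset.sum_comm]
    refine Finset.sum_congr rfl fun k _ => ?_
    rw [Matrix.diag_apply, Matrix.mul_apply]
    refine Finset.sum_congr rfl fun i _ => ?_
    rw [Matrix.mul_apply, Finset.mul_sum]
    refine Finset.sum_congr rfl fun i' _ => ?_
    rw [Matrix.mul_apply, Finset.mul_sum, Finset.mul_sum]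
    refine Finset.sum_congr rfl fun k' _ => ?_
    rw [Matrix.transpose_apply]
    ring
  calc ∑ j, w j * ((M j).transpose * G * M j * H).trace
      = ∑ i, ∑ k, ∑ i', ∑ k', G i i' * H k' k * ∑ j, w j * (M j i k * M j i' k') := by
        simp only [e, Finset.mul_sum]
        rw [Finset.sum_comm]
        refine Finset.sum_congr rfl fun i _ => ?_
        rw [Finset.sum_comm]
        refine Finset.sum_congr rfl fun k _ => ?_
        rw [Finset.sum_comm]
        refine Finset.sum_congr rfl fun i' _ => ?_
        rw [Finset.sum_comm]
        exact Finset.sum_congr rfl fun k' _ => Finset.sum_congr rfl fun j _ => by ring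
    _ = _ := by
        have hs : ∀ i i', G i i' = G i' i := fun i i' =>
          congrFun (congrFun (transpose_leftMarginal w M) i') i
        simp only [h.average_eq, Matrix.trace, Matrix.diag_apply, Matrix.mul_apply]
        rw [Finset.sum_mul_sum]
        refine Finset.sum_congr rfl fun i _ => Finset.sum_congr rfl fun k _ => ?_
        rw [Finset.sum_mul_sum]
        refine Finset.sum_congr rfl fun i' _ => Finset.sum_congr rfl fun k' _ => ?_
        rw [← hG, ← hH, hs i' i]
        ring

section Stability

variable {κ : ℝ}

theorem sum_norm_sub_le (h : IsProductEnsemble w M) (hκ : 0 < κ)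
    (hX : ∑ j, w j * ((M j * (M j).transpose - leftMarginal w M) *
      (M j * (M j).transpose - leftMarginal w M)).trace ≤ κ ^ 2) :
    ∑ j, w j * ‖M j * (M j).transpose - leftMarginal w M‖ ≤ κ := by
  refine weighted_sum_le_of_weighted_sum_sq_le (fun j => (h.pos j).le) h.sum_eq_one hκ ?_
  refine le_of_eq_of_le (Finset.sum_congr rfl fun j _ => ?_) hX
  rw [frobenius_norm_sq_eq_trace, Matrix.transpose_sub, transpose_leftMarginal,
    Matrix.transpose_mul, Matrix.transpose_transpose]

theorem sum_const_mul (h : IsProductEnsemble w M) (c : ℝ) : ∑ j, w j * c = c := by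
  rw [← Finset.sum_mul, h.sum_eq_one, one_mul]

theorem abs_purity_sub_purity_le (h : IsProductEnsemble w M)
    (hX : ∑ j, w j * ‖M j * (M j).transpose - leftMarginal w M‖ ≤ κ)
    (hY : ∑ j, w j * ‖(M j).transpose * M j - leftMarginal w (fun j => (M j).transpose)‖ ≤ κ) :
    |(leftMarginal w M * leftMarginal w M).trace -
      (leftMarginal w (fun j => (M j).transpose) *
        leftMarginal w (fun j => (M j).transpose)).trace| ≤ 4 * κ := by
  set G := leftMarginal w M
  set H := leftMarginal w (fun j => (M j).transpose)
  have h1 : ∀ j, |(G * G).trace - (H * H).trace| ≤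
      2 * ‖M j * (M j).transpose - G‖ + 2 * ‖(M j).transpose * M j - H‖ := by
    intro j
    have a := trace_sq_sub_trace_sq_le h.norm_leftMarginal_le_one (h.norm_mul_transpose_le_one j)
    have b := trace_sq_sub_trace_sq_le h.transpose.norm_leftMarginal_le_one
      (h.transpose.norm_mul_transpose_le_one j)
    rw [Matrix.transpose_transpose] at b
    have c : (M j * (M j).transpose * (M j * (M j).transpose)).trace =
        ((M j).transpose * M j * ((M j).transpose * M j)).trace := by
      rw [Matrix.mul_assoc, Matrix.trace_mul_comm]
      simp only [Matrix.mul_assoc]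
    rw [c] at a
    rw [abs_le] at a b ⊢
    constructor <;> linarith [a.1, a.2, b.1, b.2]
  rw [← h.sum_const_mul |(G * G).trace - (H * H).trace|]
  refine (Finset.sum_le_sum fun j _ => mul_le_mul_of_nonneg_left (h1 j) (h.pos j).le).trans ?_
  simp only [mul_add, Finset.sum_add_distrib, mul_left_comm _ (2 : ℝ), ← Finset.mul_sum]
  linarith

theorem trace_cube_marginal_le (h : IsProductEnsemble w M)
    (hX : ∑ j, w j * ‖M j * (M j).transpose - leftMarginal w M‖ ≤ κ)
    (hY : ∑ j, w j * ‖(M j).transpose * M j - leftMarginal w (fun j => (M j).transpose)‖ ≤ κ) :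
    (leftMarginal w M * leftMarginal w M * leftMarginal w M).trace ≤
      (leftMarginal w M * leftMarginal w M).trace ^ 2 + 9 * κ := by
  have hd := h.abs_purity_sub_purity_le hX hY
  have hQ := h.sum_trace_eq
  set G := leftMarginal w M
  set H := leftMarginal w (fun j => (M j).transpose)
  have h1 : (G * G * G).trace ≤ (G * G).trace * (H * H).trace + 5 * κ := by
    rw [← h.sum_const_mul (G * G * G).trace]
    refine (Finset.sum_le_sum fun j _ => mul_le_mul_of_nonneg_left
      (trace_cube_le h.norm_leftMarginal_le_one h.transpose.norm_leftMarginal_le_one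
        (h.norm_eq_one j).le) (h.pos j).le).trans ?_
    simp only [mul_add, Finset.sum_add_distrib, mul_left_comm _ (4 : ℝ), ← Finset.mul_sum]
    rw [hQ]
    linarith
  have h2 : (G * G).trace = ‖G‖ ^ 2 := by
    rw [frobenius_norm_sq_eq_trace, transpose_leftMarginal]
  have h3 : ‖G‖ ^ 2 ≤ 1 := pow_le_one₀ (norm_nonneg _) h.norm_leftMarginal_le_one
  rw [abs_le] at hd
  rw [h2] at hd h1 ⊢
  nlinarith [sq_nonneg ‖G‖]

theorem leftMarginal_apply_nonneg (h : IsProductEnsemble w M) (h0 : ∀ j i k, 0 ≤ M j i k)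
    (i i' : m) : 0 ≤ leftMarginal w M i i' := by
  rw [leftMarginal, Matrix.sum_apply]
  refine Finset.sum_nonneg fun j _ => ?_
  rw [Matrix.smul_apply, smul_eq_mul, Matrix.mul_apply]
  exact mul_nonneg (h.pos j).le (Finset.sum_nonneg fun k _ => mul_nonneg (h0 j i k) (h0 j i' k))

theorem mul_diag_sub_le (h : IsProductEnsemble w M) (h0 : ∀ j i k, 0 ≤ M j i k)
    (hX : ∑ j, w j * ‖M j * (M j).transpose - leftMarginal w M‖ ≤ κ) (i i' : m) :
    leftMarginal w M i i * leftMarginal w M i' i' - 2 * κ ≤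
      Fintype.card n ^ 2 * leftMarginal w M i i' := by
  have hGnn := h.leftMarginal_apply_nonneg h0
  have hG1 : ∀ i i', leftMarginal w M i i' ≤ 1 := fun i i' =>
    (le_abs_self _).trans ((abs_apply_le_frobenius_norm _ i i').trans h.norm_leftMarginal_le_one)
  have hH1 : ∀ k k', leftMarginal w (fun j => (M j).transpose) k k' ≤ 1 := fun k k' =>
    (le_abs_self _).trans
      ((abs_apply_le_frobenius_norm _ k k').trans h.transpose.norm_leftMarginal_le_one)
  have h1 : ∑ j, w j * ((∑ k, M j i k) * (∑ k, M j i' k)) ≤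
      Fintype.card n ^ 2 * leftMarginal w M i i' := by
    have e : ∑ j, w j * ((∑ k, M j i k) * (∑ k, M j i' k)) =
        ∑ k, ∑ k', ∑ j, w j * (M j i k * M j i' k') := by
      simp only [Finset.sum_mul_sum]
      simp only [Finset.mul_sum]
      rw [Finset.sum_comm]
      exact Finset.sum_congr rfl fun k _ => Finset.sum_comm
    rw [e]
    simp only [h.average_eq]
    calc ∑ k, ∑ k', leftMarginal w M i i' * leftMarginal w (fun j => (M j).transpose) k k'
        ≤ ∑ _k : n, ∑ _k' : n, leftMarginal w M i i' :=
          Finset.sum_le_sum fun k _ => Finset.sum_le_sum fun k' _ =>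
            mul_le_of_le_one_right (hGnn i i') (hH1 k k')
      _ = _ := by
          simp only [Finset.sum_const, Finset.card_univ, nsmul_eq_mul]
          ring
  refine le_trans ?_ h1
  have hentry : ∀ j i k, M j i k ≤ 1 := fun j i k =>
    (le_abs_self _).trans ((abs_apply_le_frobenius_norm _ i k).trans (h.norm_eq_one j).le)
  have hdiag0 : ∀ j i, 0 ≤ (M j * (M j).transpose) i i := fun j i => by
    rw [Matrix.mul_apply]
    exact Finset.sum_nonneg fun k _ => mul_nonneg (h0 j i k) (h0 j i k)
  have hdiag : ∀ j i, (M j * (M j).transpose) i i ≤ ∑ k, M j i k := fun j i => by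
    rw [Matrix.mul_apply]
    exact Finset.sum_le_sum fun k _ => mul_le_of_le_one_right (h0 j i k) (hentry j i k)
  have h2 : ∀ j, leftMarginal w M i i * leftMarginal w M i' i' -
      2 * ‖M j * (M j).transpose - leftMarginal w M‖ ≤ (∑ k, M j i k) * (∑ k, M j i' k) := by
    intro j
    refine le_trans ?_ (mul_le_mul (hdiag j i) (hdiag j i') (hdiag0 j i')
      ((hdiag0 j i).trans (hdiag j i)))
    have a := abs_apply_le_frobenius_norm (M j * (M j).transpose - leftMarginal w M) i i
    have b := abs_apply_le_frobenius_norm (M j * (M j).transpose - leftMarginal w M) i' i'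
    have c : (M j * (M j).transpose) i i ≤ 1 := (le_abs_self _).trans
      ((abs_apply_le_frobenius_norm _ i i).trans (h.norm_mul_transpose_le_one j))
    rw [Matrix.sub_apply, abs_le] at a b
    have d := hG1 i' i'
    have e := hdiag0 j i
    have f := hGnn i' i'
    have g := norm_nonneg (M j * (M j).transpose - leftMarginal w M)
    set X := ‖M j * (M j).transpose - leftMarginal w M‖
    have p1 : leftMarginal w M i i * leftMarginal w M i' i' ≤
        (M j * (M j).transpose) i i * leftMarginal w M i' i' + X := by nlinarith
    have p2 : (M j * (M j).transpose) i i * leftMarginal w M i' i' ≤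
        (M j * (M j).transpose) i i * (M j * (M j).transpose) i' i' + X := by nlinarith
    linarith
  refine le_trans ?_ (Finset.sum_le_sum fun j _ =>
    mul_le_mul_of_nonneg_left (h2 j) (h.pos j).le)
  simp only [mul_sub, Finset.sum_sub_distrib, h.sum_const_mul, mul_left_comm _ (2 : ℝ),
    ← Finset.mul_sum]
  linarith

end Stability

end IsProductEnsemble

end Frobenius

section Rigidity

variable {m : Type*} [Fintype m]

theorem trace_transpose_mul_self (B : Matrix m m ℝ) :
    (B.transpose * B).trace = ∑ i, ∑ j, B j i ^ 2 := by
  simp [Matrix.trace, Matrix.mul_apply, sq]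

theorem trace_cube_sub_sq_eq {B G : Matrix m m ℝ} (hG : G = B.transpose * B)
    (ht : G.trace = 1) :
    (G * G * G).trace - (G * G).trace ^ 2 =
      ((B * G - (G * G).trace • B).transpose * (B * G - (G * G).trace • B)).trace := by
  have hs : G.transpose = G := by
    rw [hG, Matrix.transpose_mul, Matrix.transpose_transpose]
  generalize hτ : (G * G).trace = t
  have e : (B * G - t • B).transpose * (B * G - t • B) =
      G * G * G - t • (G * G) - t • (G * G) + (t * t) • G := by
    have h1 : (B * G).transpose * (B * G) = G * G * G := by
      rw [Matrix.transpose_mul, hs, Matrix.mul_assoc, ← Matrix.mul_assoc B.transpose, ← hG,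
        ← Matrix.mul_assoc]
    have h2 : (B * G).transpose * B = G * G := by
      rw [Matrix.transpose_mul, hs, Matrix.mul_assoc, ← hG]
    have h3 : B.transpose * (B * G) = G * G := by
      rw [← Matrix.mul_assoc, ← hG]
    rw [Matrix.transpose_sub, Matrix.transpose_smul, Matrix.sub_mul, Matrix.mul_sub,
      Matrix.mul_sub, Matrix.mul_smul, Matrix.smul_mul, Matrix.smul_mul, Matrix.mul_smul,
      h1, h2, h3, ← hG, smul_smul]
    abel
  rw [e, Matrix.trace_add, Matrix.trace_sub, Matrix.trace_sub, Matrix.trace_smul,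
    Matrix.trace_smul, hτ, ht, smul_eq_mul, smul_eq_mul]
  ring

theorem sq_trace_sq_le_trace_cube {B G : Matrix m m ℝ} (hG : G = B.transpose * B)
    (ht : G.trace = 1) : (G * G).trace ^ 2 ≤ (G * G * G).trace := by
  have h := trace_cube_sub_sq_eq hG ht
  rw [trace_transpose_mul_self] at h
  have : 0 ≤ ∑ i, ∑ j, (B * G - (G * G).trace • B) j i ^ 2 :=
    Finset.sum_nonneg fun i _ => Finset.sum_nonneg fun j _ => sq_nonneg _
  linarith

theorem mul_self_eq_smul_of_trace_cube_le {B G : Matrix m m ℝ} (hG : G = B.transpose * B)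
    (ht : G.trace = 1) (h3 : (G * G * G).trace ≤ (G * G).trace ^ 2) :
    G * G = (G * G).trace • G := by
  have h := trace_cube_sub_sq_eq hG ht
  have h0 : ((B * G - (G * G).trace • B).transpose * (B * G - (G * G).trace • B)).trace = 0 := by
    have h' := trace_transpose_mul_self (B * G - (G * G).trace • B)
    have : 0 ≤ ∑ i, ∑ j, (B * G - (G * G).trace • B) j i ^ 2 :=
      Finset.sum_nonneg fun i _ => Finset.sum_nonneg fun j _ => sq_nonneg _
    linarith
  rw [← Matrix.conjTranspose_eq_transpose_of_trivial,
    Matrix.trace_conjTranspose_mul_self_eq_zero_iff] at h0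
  have h4 : B.transpose * (B * G) = B.transpose * ((G * G).trace • B) := by
    rw [sub_eq_zero.1 h0]
  rwa [← Matrix.mul_assoc, Matrix.mul_smul, ← hG] at h4

theorem sq_apply_le_of_eq_transpose_mul_self {B G : Matrix m m ℝ} (hG : G = B.transpose * B)
    (i j : m) : G i j ^ 2 ≤ G i i * G j j := by
  have := Finset.sum_mul_sq_le_sq_mul_sq Finset.univ (fun k => B k i) (fun k => B k j)
  simpa [hG, Matrix.mul_apply, sq] using this

theorem sq_apply_eq_of_mul_self_eq_smul {B G : Matrix m m ℝ} (hG : G = B.transpose * B)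
    {t : ℝ} (ht : G * G = t • G) (h0 : ∀ i j, 0 ≤ G i j)
    (hpos : ∀ i j, 0 < G i i → 0 < G j j → 0 < G i j) (i j : m) :
    G i j ^ 2 = G i i * G j j := by
  have hCS := sq_apply_le_of_eq_transpose_mul_self hG
  rcases (h0 i i).eq_or_lt with hi | hi
  · refine le_antisymm (hCS i j) ?_
    rw [← hi, zero_mul]
    exact sq_nonneg _
  rcases (h0 j j).eq_or_lt with hj | hj
  · refine le_antisymm (hCS i j) ?_
    rw [← hj, mul_zero]
    exact sq_nonneg _
  have hs : ∀ i j, G i j = G j i := fun i j => by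
    simp [hG, Matrix.mul_apply, mul_comm]
  obtain ⟨k, hk, hmin⟩ := Finset.exists_min_image (Finset.univ.filter fun l => 0 < G l l)
    (fun l => G l j / G l i) ⟨i, by simpa using hi⟩
  simp only [Finset.mem_filter, Finset.mem_univ, true_and] at hk hmin
  set r := G k j / G k i with hr
  have hki := hpos k i hk hi
  have hz : ∀ l, 0 < G l l → 0 ≤ G l j - r * G l i := fun l hl => by
    have h := hmin l hl
    rw [le_div_iff₀ (hpos l i hl hi)] at h
    linarith
  have hzk : G k j - r * G k i = 0 := by
    rw [hr, div_mul_cancel₀ _ hki.ne', sub_self]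
  have hterm : ∀ l, 0 ≤ G k l * (G l j - r * G l i) := fun l => by
    rcases (h0 l l).eq_or_lt with hl | hl
    · have h := hCS k l
      rw [← hl, mul_zero] at h
      have : G k l = 0 := pow_eq_zero_iff two_ne_zero |>.1 (le_antisymm h (sq_nonneg _))
      rw [this, zero_mul]
    · exact mul_nonneg (h0 k l) (hz l hl)
  have hsum : ∑ l, G k l * (G l j - r * G l i) = 0 := by
    have e : ∀ a, ∑ l, G k l * G l a = t * G k a := fun a => by
      rw [← Matrix.mul_apply, ht, Matrix.smul_apply, smul_eq_mul]
    calc ∑ l, G k l * (G l j - r * G l i)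
        = ∑ l, G k l * G l j - r * ∑ l, G k l * G l i := by
          rw [Finset.mul_sum, ← Finset.sum_sub_distrib]
          exact Finset.sum_congr rfl fun l _ => by ring
      _ = t * (G k j - r * G k i) := by
          rw [e, e]
          ring
      _ = 0 := by rw [hzk, mul_zero]
  have hzero : ∀ l, 0 < G l l → G l j = r * G l i := fun l hl => by
    have h := (Finset.sum_eq_zero_iff_of_nonneg fun l _ => hterm l).1 hsum l (Finset.mem_univ l)
    have := (mul_eq_zero.1 h).resolve_left (hpos k l hk hl).ne'
    linarith
  have h1 := hzero i hi
  have h2 := hzero j hj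
  rw [h2, ← hs i j, h1]
  ring

theorem trace_sq_eq_one_of_rigid {B G : Matrix m m ℝ} (hG : G = B.transpose * B)
    (ht : G.trace = 1) (h0 : ∀ i j, 0 ≤ G i j) (h3 : (G * G * G).trace ≤ (G * G).trace ^ 2)
    {N : ℝ} (hN : ∀ i j, G i i * G j j ≤ N * G i j) : (G * G).trace = 1 := by
  have hpos : ∀ i j, 0 < G i i → 0 < G j j → 0 < G i j := fun i j hi hj => by
    refine (h0 i j).lt_of_ne fun h => ?_
    have := hN i j
    rw [← h, mul_zero] at this
    exact absurd (mul_pos hi hj) this.not_gt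
  have hsq := sq_apply_eq_of_mul_self_eq_smul hG
    (mul_self_eq_smul_of_trace_cube_le hG ht h3) h0 hpos
  have hs : ∀ i j, G i j = G j i := fun i j => by
    simp [hG, Matrix.mul_apply, mul_comm]
  calc (G * G).trace = ∑ i, ∑ j, G i i * G j j := by
        rw [Matrix.trace]
        refine Finset.sum_congr rfl fun i _ => ?_
        rw [Matrix.diag_apply, Matrix.mul_apply]
        refine Finset.sum_congr rfl fun j _ => ?_
        rw [← hsq, hs j i, sq]
    _ = G.trace * G.trace := by
        rw [← Finset.sum_mul_sum]
        rfl
    _ = 1 := by rw [ht, one_mul]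

theorem exists_eq_transpose_mul_self {G : Matrix m m ℝ} (hG : G.PosSemidef) (ht : G.trace = 1) :
    ∃ B : Matrix m m ℝ, G = B.transpose * B := by
  classical
  obtain ⟨U, p, -, -, rfl, hp, -, -⟩ := exists_spectral_decomposition hG ht
  refine ⟨Matrix.diagonal (fun i => √(p i)) * U.transpose, ?_⟩
  rw [Matrix.transpose_mul, Matrix.transpose_transpose, Matrix.diagonal_transpose,
    Matrix.mul_assoc, Matrix.mul_assoc, ← Matrix.mul_assoc (Matrix.diagonal _)
    (Matrix.diagonal _), Matrix.diagonal_mul_diagonal]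
  simp only [Real.mul_self_sqrt (hp _)]

theorem exists_pos_le_defect (m : Type*) [Fintype m] (N : ℝ) {ℓ : ℝ} (hℓ : 0 < ℓ) :
    ∃ μ : ℝ, 0 < μ ∧ ∀ G : Matrix m m ℝ, G.PosSemidef → G.trace = 1 → (∀ i j, 0 ≤ G i j) →
      (G * G).trace ≤ 1 - ℓ → ∀ η : ℝ, (G * G * G).trace ≤ (G * G).trace ^ 2 + η →
      (∀ i j, G i i * G j j - η ≤ N * G i j) → μ ≤ η := by
  let g : Matrix m m ℝ → Matrix m m ℝ := fun B => B.transpose * B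
  have hg : Continuous g := by fun_prop
  let F : Matrix m m ℝ → ℝ := fun B => ((g B * g B * g B).trace - (g B * g B).trace ^ 2) +
    ∑ i, ∑ j, max 0 (g B i i * g B j j - N * g B i j)
  have hge : ∀ i j, Continuous fun B => g B i j := fun i j => hg.matrix_elem i j
  have hF : Continuous F := by fun_prop
  let S : Set (Matrix m m ℝ) :=
    {B | (g B).trace = 1} ∩ ({B | ∀ i j, 0 ≤ g B i j} ∩ {B | (g B * g B).trace ≤ 1 - ℓ})
  have hSclosed : IsClosed S := by
    refine IsClosed.inter (isClosed_eq (by fun_prop) continuous_const)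
      (IsClosed.inter ?_ (isClosed_le (by fun_prop) continuous_const))
    simp only [Set.ofPred_forall]
    exact isClosed_iInter fun i => isClosed_iInter fun j =>
      isClosed_le continuous_const (hge i j)
  have hScompact : IsCompact S := by
    have hbox : IsCompact (Set.pi Set.univ fun _ : m => Set.pi Set.univ fun _ : m =>
        Set.Icc (-1 : ℝ) 1) :=
      isCompact_univ_pi fun _ => isCompact_univ_pi fun _ => isCompact_Icc
    refine hbox.of_isClosed_subset hSclosed fun B hB => ?_
    have hB1 : ∑ i, ∑ j, B j i ^ 2 = 1 := by
      exact (trace_transpose_mul_self (B : Matrix m m ℝ)).symm.trans hB.1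
    intro j _ i _
    have h1 : B j i ^ 2 ≤ 1 := by
      rw [← hB1]
      exact (Finset.single_le_sum (f := fun j => B j i ^ 2) (fun j _ => sq_nonneg _)
        (Finset.mem_univ j)).trans (Finset.single_le_sum (f := fun i => ∑ j, B j i ^ 2)
          (fun i _ => Finset.sum_nonneg fun j _ => sq_nonneg _) (Finset.mem_univ i))
    exact abs_le.1 ((sq_le_one_iff_abs_le_one _).1 h1)
  have hFpos : ∀ B ∈ S, 0 < F B := by
    intro B hB
    by_contra! hle
    have h1 := sq_trace_sq_le_trace_cube (G := g B) rfl hB.1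
    have h2 : 0 ≤ ∑ i, ∑ j, max 0 (g B i i * g B j j - N * g B i j) :=
      Finset.sum_nonneg fun i _ => Finset.sum_nonneg fun j _ => le_max_left _ _
    have h3 : ∑ i, ∑ j, max 0 (g B i i * g B j j - N * g B i j) = 0 := by
      simp only [F] at hle
      linarith
    have h4 : ∀ i j, g B i i * g B j j ≤ N * g B i j := fun i j => by
      have a := (Finset.sum_eq_zero_iff_of_nonneg fun i _ =>
        Finset.sum_nonneg fun j _ => le_max_left _ _).1 h3 i (Finset.mem_univ i)
      have b := (Finset.sum_eq_zero_iff_of_nonneg fun j _ => le_max_left _ _).1 a j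
        (Finset.mem_univ j)
      have c := le_max_right 0 (g B i i * g B j j - N * g B i j)
      linarith
    have h5 := trace_sq_eq_one_of_rigid (G := g B) rfl hB.1 hB.2.1
      (by simp only [F] at hle; linarith) h4
    have h6 : (g B * g B).trace ≤ 1 - ℓ := hB.2.2
    linarith
  obtain ⟨ν, hν, hνF⟩ : ∃ ν : ℝ, 0 < ν ∧ ∀ B ∈ S, ν ≤ F B := by
    rcases S.eq_empty_or_nonempty with hS | hS
    · exact ⟨1, one_pos, by simp [hS]⟩
    · obtain ⟨B, hB, hmin⟩ := hScompact.exists_isMinOn hS hF.continuousOn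
      exact ⟨F B, hFpos B hB, hmin⟩
  have hden : (0 : ℝ) < 1 + Fintype.card m * Fintype.card m := by positivity
  refine ⟨ν / (1 + Fintype.card m * Fintype.card m), div_pos hν hden, ?_⟩
  intro G hG ht h0 hℓG η h3 hN
  obtain ⟨B, hB⟩ := exists_eq_transpose_mul_self hG ht
  have hη : 0 ≤ η := by linarith [sq_trace_sq_le_trace_cube hB ht]
  have hgB : g B = G := hB.symm
  have hBS : B ∈ S := by
    refine ⟨?_, ?_, ?_⟩ <;> simpa only [Set.mem_ofPred_eq, hgB]
  have hle := hνF B hBS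
  simp only [F, hgB] at hle
  have hsum : ∑ i, ∑ j, max 0 (G i i * G j j - N * G i j) ≤ ∑ _i : m, ∑ _j : m, η :=
    Finset.sum_le_sum fun i _ => Finset.sum_le_sum fun j _ =>
      max_le hη (by linarith [hN i j])
  simp only [Finset.sum_const, Finset.card_univ, nsmul_eq_mul] at hsum
  rw [div_le_iff₀ hden]
  linarith

end Rigidity

namespace IsProductEnsemble

variable {ι m n : Type*} [Fintype ι] [Fintype m] [Fintype n] [DecidableEq m] [DecidableEq n]
  {w : ι → ℝ} {M : ι → Matrix m n ℝ}

omit [DecidableEq n] in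
theorem specEntropy_leftMarginal_le (h : IsProductEnsemble w M) :
    specEntropy (leftMarginal w M) ≤ 2 * Fintype.card m := by
  refine (specEntropy_le_sqrt h.posSemidef_leftMarginal h.trace_leftMarginal).trans
    (mul_le_of_le_one_right (by positivity) (Real.sqrt_le_one.2 ?_))
  have : 0 ≤ (leftMarginal w M * leftMarginal w M).trace := by
    have e := trace_transpose_mul_self (leftMarginal w M)
    rw [transpose_leftMarginal] at e
    rw [e]
    positivity
  linarith

omit [DecidableEq n] in
theorem specEntropy_leftMarginal_nonneg (h : IsProductEnsemble w M) :
    0 ≤ specEntropy (leftMarginal w M) :=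
  specEntropy_nonneg h.posSemidef_leftMarginal h.trace_leftMarginal

omit [DecidableEq n] in
theorem sum_trace_sq_sub_le (h : IsProductEnsemble w M) :
    ∑ j, w j * ((M j * (M j).transpose - leftMarginal w M) *
      (M j * (M j).transpose - leftMarginal w M)).trace ≤
      4 * (specEntropy (leftMarginal w M) -
        ∑ j, w j * specEntropy (M j * (M j).transpose)) :=
  sum_trace_sq_sub_le_entropy_gap h.pos h.sum_eq_one (fun j => posSemidef_mul_transpose (M j))
    h.trace_eq_one rfl

theorem sum_entropy_le_half_max (h : IsProductEnsemble w M) {C : ℝ}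
    (hC : C = 4 * (Fintype.card m ^ 3 * Fintype.card n ^ 2))
    (hA : 1 - (leftMarginal w M * leftMarginal w M).trace ≤ Real.exp (-(2 * (2 * C))))
    (hB : 1 - (leftMarginal w (fun j => (M j).transpose) *
      leftMarginal w (fun j => (M j).transpose)).trace ≤ Real.exp (-(2 * (2 * C)))) :
    ∑ j, w j * specEntropy (M j * (M j).transpose) ≤
      1 / 2 * max (specEntropy (leftMarginal w M))
        (specEntropy (leftMarginal w (fun j => (M j).transpose))) := by
  have hC0 : 0 ≤ C := by rw [hC]; positivity
  have h1 := h.sum_entropy_le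
  rw [← hC] at h1
  have h2 := mul_linear_entropy_le_specEntropy h.posSemidef_leftMarginal h.trace_leftMarginal
    (by positivity) hA
  have h3 := mul_linear_entropy_le_specEntropy h.transpose.posSemidef_leftMarginal
    h.transpose.trace_leftMarginal (by positivity) hB
  have h4 := trace_mul_self_le_one h.posSemidef_leftMarginal h.trace_leftMarginal
  have h5 := trace_mul_self_le_one h.transpose.posSemidef_leftMarginal
    h.transpose.trace_leftMarginal
  set a := 1 - (leftMarginal w M * leftMarginal w M).trace
  set b := 1 - (leftMarginal w (fun j => (M j).transpose) *
      leftMarginal w (fun j => (M j).transpose)).trace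
  have ha : 0 ≤ a := sub_nonneg.2 h4
  have hb : 0 ≤ b := sub_nonneg.2 h5
  have h6 : √a * √b ≤ max a b := by
    calc √a * √b ≤ √(max a b) * √(max a b) :=
          mul_le_mul (Real.sqrt_le_sqrt (le_max_left _ _)) (Real.sqrt_le_sqrt (le_max_right _ _))
            (Real.sqrt_nonneg _) (Real.sqrt_nonneg _)
      _ = max a b := Real.mul_self_sqrt (ha.trans (le_max_left _ _))
  have h7 : 2 * C * max a b ≤ max (specEntropy (leftMarginal w M))
        (specEntropy (leftMarginal w (fun j => (M j).transpose))) := by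
    rw [mul_max_of_nonneg _ _ (by positivity)]
    exact max_le_max h2 h3
  have h8 := mul_le_mul_of_nonneg_left h6 hC0
  linarith

theorem sum_specEntropy_transpose_mul :
    ∑ j, w j * specEntropy ((M j).transpose * (M j).transpose.transpose) =
      ∑ j, w j * specEntropy (M j * (M j).transpose) :=
  Finset.sum_congr rfl fun j _ => by
    rw [Matrix.transpose_transpose, specEntropy_mul_transpose]

end IsProductEnsemble

theorem exists_entropy_contraction (m n : Type*) [Fintype m] [Fintype n] [DecidableEq m]
    [DecidableEq n] :
    ∃ c : ℝ, c < 1 ∧ ∀ (ι : Type) [Fintype ι] (w : ι → ℝ) (M : ι → Matrix m n ℝ),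
      IsProductEnsemble w M → (∀ j i k, 0 ≤ M j i k) →
      ∑ j, w j * specEntropy (M j * (M j).transpose) ≤
        c * max (specEntropy (leftMarginal w M))
          (specEntropy (leftMarginal w (fun j => (M j).transpose))) := by
  obtain ⟨C, hC⟩ : ∃ C : ℝ, C = 4 * (Fintype.card m ^ 3 * Fintype.card n ^ 2) := ⟨_, rfl⟩
  obtain ⟨ℓ, hℓe⟩ : ∃ ℓ : ℝ, ℓ = Real.exp (-(2 * (2 * C))) := ⟨_, rfl⟩
  have hℓ : 0 < ℓ := hℓe ▸ Real.exp_pos _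
  obtain ⟨μ, hμ, hdefect⟩ := exists_pos_le_defect m ((Fintype.card n : ℝ) ^ 2) (half_pos hℓ)
  obtain ⟨κ, hκ, hκμ, hκℓ⟩ : ∃ κ : ℝ, 0 < κ ∧ 9 * κ < μ ∧ 4 * κ ≤ ℓ / 2 := by
    refine ⟨min (μ / 10) (ℓ / 8), by positivity, ?_, ?_⟩
    · linarith [min_le_left (μ / 10) (ℓ / 8)]
    · linarith [min_le_right (μ / 10) (ℓ / 8)]
  obtain ⟨D, hD⟩ : ∃ D : ℝ, D = 2 * Fintype.card m + 2 * Fintype.card n := ⟨_, rfl⟩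
  have hD0 : 0 ≤ D := by rw [hD]; positivity
  obtain ⟨δ, hδ, hδκ⟩ : ∃ δ : ℝ, 0 < δ ∧ 4 * (δ * D) ≤ κ ^ 2 := by
    refine ⟨κ ^ 2 / (4 * D + 1), by positivity, ?_⟩
    have : κ ^ 2 / (4 * D + 1) * (4 * D + 1) = κ ^ 2 := div_mul_cancel₀ _ (by positivity)
    have : 0 < κ ^ 2 / (4 * D + 1) := by positivity
    linarith
  refine ⟨max (1 / 2) (1 - δ), max_lt (by norm_num) (by linarith), ?_⟩
  intro ι _ w M h h0
  have hSA := h.specEntropy_leftMarginal_nonneg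
  have hSAD := h.specEntropy_leftMarginal_le
  have hSBD := h.transpose.specEntropy_leftMarginal_le
  set S := max (specEntropy (leftMarginal w M))
    (specEntropy (leftMarginal w (fun j => (M j).transpose))) with hS
  have hSl : specEntropy (leftMarginal w M) ≤ S := le_max_left _ _
  have hSr : specEntropy (leftMarginal w (fun j => (M j).transpose)) ≤ S := le_max_right _ _
  have hS0 : 0 ≤ S := hSA.trans hSl
  have hSD : S ≤ D := by
    rw [hD]
    exact max_le (by linarith [(Fintype.card n).cast_nonneg (α := ℝ)])
      (by linarith [(Fintype.card m).cast_nonneg (α := ℝ)])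
  by_contra! hcon
  have hgap : (1 - δ) * S < ∑ j, w j * specEntropy (M j * (M j).transpose) :=
    (mul_le_mul_of_nonneg_right (le_max_right _ _) hS0).trans_lt hcon
  have hδS : δ * S ≤ δ * D := mul_le_mul_of_nonneg_left hSD hδ.le
  have hX := h.sum_norm_sub_le hκ (h.sum_trace_sq_sub_le.trans
    (by linarith))
  have hY := h.transpose.sum_norm_sub_le hκ (h.transpose.sum_trace_sq_sub_le.trans
    (by
      rw [IsProductEnsemble.sum_specEntropy_transpose_mul]
      linarith))
  simp only [Matrix.transpose_transpose] at hY
  have hpur := abs_le.1 (h.abs_purity_sub_purity_le hX hY)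
  by_cases hlarge : (leftMarginal w M * leftMarginal w M).trace ≤ 1 - ℓ / 2
  · refine hκμ.not_ge (hdefect _ h.posSemidef_leftMarginal h.trace_leftMarginal
      (h.leftMarginal_apply_nonneg h0) hlarge _ (h.trace_cube_marginal_le hX hY) fun i j => ?_)
    linarith [h.mul_diag_sub_le h0 hX i j]
  · refine hcon.not_ge ((h.sum_entropy_le_half_max hC ?_ ?_).trans
      (mul_le_mul_of_nonneg_right (le_max_left _ _) hS0)) <;> rw [← hℓe] <;>
      linarith [hpur.1, hpur.2]

section Measurement

variable {dA dB dC : ℕ} {ψ : Fin dA × Fin dB × Fin dC → ℂ}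

theorem probB_nonneg (ψ : Fin dA × Fin dB × Fin dC → ℂ) (j : Fin dB) : 0 ≤ probB ψ j :=
  Finset.sum_nonneg fun _ _ => Finset.sum_nonneg fun _ _ => Complex.normSq_nonneg _

/-- The real coefficient matrix of the normalized post-measurement state for outcome `j`. -/
noncomputable def postMatrix (ψ : Fin dA × Fin dB × Fin dC → ℂ) (j : Fin dB) :
    Matrix (Fin dA) (Fin dC) ℝ :=
  Matrix.of fun i k => (ψ (i, j, k)).re / √(probB ψ j)

theorem NonNeg.postMatrix_nonneg (h : NonNeg ψ) (j : Fin dB) (i : Fin dA) (k : Fin dC) :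
    0 ≤ postMatrix ψ j i k :=
  div_nonneg (h _).1 (Real.sqrt_nonneg _)

theorem NonNeg.mul_conj_eq (h : NonNeg ψ) (x y : Fin dA × Fin dB × Fin dC) :
    ψ x * (starRingEnd ℂ) (ψ y) = ((ψ x).re * (ψ y).re : ℝ) := by
  apply Complex.ext <;> simp [(h x).2, (h y).2]

theorem NonNeg.normSq_eq (h : NonNeg ψ) (x : Fin dA × Fin dB × Fin dC) :
    Complex.normSq (ψ x) = (ψ x).re * (ψ x).re := by
  rw [Complex.normSq_apply, (h x).2, mul_zero, add_zero]

theorem apply_eq_zero_of_probB_eq_zero {j : Fin dB} (hj : probB ψ j = 0) (i : Fin dA)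
    (k : Fin dC) : ψ (i, j, k) = 0 := by
  have h1 := (Finset.sum_eq_zero_iff_of_nonneg fun i _ =>
    Finset.sum_nonneg fun k _ => Complex.normSq_nonneg _).1 hj i (Finset.mem_univ i)
  have h2 := (Finset.sum_eq_zero_iff_of_nonneg fun k _ => Complex.normSq_nonneg _).1 h1 k
    (Finset.mem_univ k)
  exact Complex.normSq_eq_zero.1 h2

theorem probB_mul_postMatrix_mul (ψ : Fin dA × Fin dB × Fin dC → ℂ) (j : Fin dB)
    (i i' : Fin dA) (k k' : Fin dC) :
    probB ψ j * (postMatrix ψ j i k * postMatrix ψ j i' k') =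
      (ψ (i, j, k)).re * (ψ (i', j, k')).re := by
  rcases (probB_nonneg ψ j).eq_or_lt with hj | hj
  · rw [← hj, apply_eq_zero_of_probB_eq_zero hj.symm]
    simp
  · have h := Real.mul_self_sqrt hj.le
    have h' : √(probB ψ j) ≠ 0 := (Real.sqrt_pos.2 hj).ne'
    simp only [postMatrix, Matrix.of_apply]
    nth_rewrite 1 [← h]
    field_simp

theorem sum_subtype_probB_pos {E : Type*} [AddCommMonoid E] (f : Fin dB → E)
    (hf : ∀ j, probB ψ j = 0 → f j = 0) :
    ∑ j : {j // 0 < probB ψ j}, f j = ∑ j, f j := by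
  rw [← Finset.sum_subtype (Finset.univ.filter fun j => 0 < probB ψ j) (by simp) f]
  refine Finset.sum_filter_of_ne fun j _ hj => ?_
  exact (probB_nonneg ψ j).lt_of_ne fun h => hj (hf j h.symm)

theorem sum_subtype_postMatrix (ψ : Fin dA × Fin dB × Fin dC → ℂ) (i i' : Fin dA)
    (k k' : Fin dC) :
    ∑ j : {j // 0 < probB ψ j}, probB ψ j * (postMatrix ψ j i k * postMatrix ψ j i' k') =
      ∑ j, (ψ (i, j, k)).re * (ψ (i', j, k')).re := by
  rw [sum_subtype_probB_pos (fun j => probB ψ j * (postMatrix ψ j i k * postMatrix ψ j i' k'))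
    fun j hj => by rw [hj, zero_mul]]
  exact Finset.sum_congr rfl fun j _ => probB_mul_postMatrix_mul ψ j i i' k k'

theorem leftMarginal_apply {ι m n : Type*} [Fintype ι] [Fintype n] (w : ι → ℝ)
    (M : ι → Matrix m n ℝ) (i i' : m) :
    leftMarginal w M i i' = ∑ k, ∑ j, w j * (M j i k * M j i' k) := by
  rw [leftMarginal, Matrix.sum_apply, Finset.sum_comm]
  refine Finset.sum_congr rfl fun j _ => ?_
  rw [Matrix.smul_apply, smul_eq_mul, Matrix.mul_apply, Finset.mul_sum]
  rfl

theorem NonNeg.rhoA_eq (h : NonNeg ψ) :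
    rhoA ψ = (leftMarginal (fun j : {j // 0 < probB ψ j} => probB ψ j)
      (fun j => postMatrix ψ j)).map Complex.ofRealHom := by
  ext i i'
  rw [Matrix.map_apply, leftMarginal_apply]
  simp only [sum_subtype_postMatrix, rhoA, Matrix.of_apply, h.mul_conj_eq]
  rw [Finset.sum_comm]
  simp

theorem NonNeg.rhoC_eq (h : NonNeg ψ) :
    rhoC ψ = (leftMarginal (fun j : {j // 0 < probB ψ j} => probB ψ j)
      (fun j => (postMatrix ψ j).transpose)).map Complex.ofRealHom := by
  ext k k'
  rw [Matrix.map_apply, leftMarginal_apply]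
  simp only [sum_subtype_postMatrix, rhoC, Matrix.of_apply, Matrix.transpose_apply,
    h.mul_conj_eq]
  simp

theorem NonNeg.rhoAPost_eq (h : NonNeg ψ) (j : Fin dB) :
    rhoAPost ψ j = (postMatrix ψ j * (postMatrix ψ j).transpose).map Complex.ofRealHom := by
  ext i i'
  rw [Matrix.map_apply, Matrix.mul_apply]
  simp only [rhoAPost, Matrix.of_apply, h.mul_conj_eq, Matrix.transpose_apply, postMatrix,
    div_mul_div_comm, Real.mul_self_sqrt (probB_nonneg ψ j)]
  rw [← Finset.sum_div, div_eq_inv_mul]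
  simp

theorem NonNeg.trace_postMatrix (h : NonNeg ψ) {j : Fin dB} (hj : 0 < probB ψ j) :
    (postMatrix ψ j * (postMatrix ψ j).transpose).trace = 1 := by
  simp only [Matrix.trace, Matrix.diag_apply, Matrix.mul_apply, Matrix.transpose_apply,
    postMatrix, Matrix.of_apply, div_mul_div_comm, Real.mul_self_sqrt hj.le,
    ← Finset.sum_div, ← h.normSq_eq]
  exact div_self hj.ne'

theorem NonNeg.isProductEnsemble (h : NonNeg ψ) (hn : Normalized ψ)
    (hprod : rhoAC ψ = rhoA ψ ⊗ₖ rhoC ψ) :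
    IsProductEnsemble (fun j : {j // 0 < probB ψ j} => probB ψ j)
      (fun j => postMatrix ψ j) where
  pos j := j.2
  sum_eq_one := by
    rw [sum_subtype_probB_pos (probB ψ) fun _ hj => hj, ← hn]
    exact Finset.sum_comm
  trace_eq_one j := h.trace_postMatrix j.2
  average_eq i i' k k' := by
    have e := congrFun (congrFun hprod (i, k)) (i', k')
    rw [Matrix.kroneckerMap_apply, h.rhoA_eq, h.rhoC_eq, Matrix.map_apply, Matrix.map_apply,
      ← map_mul] at e
    rw [sum_subtype_postMatrix]
    apply Complex.ofReal_injective
    refine Eq.trans ?_ e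
    simp only [rhoAC, Matrix.of_apply, h.mul_conj_eq]
    simp

end Measurement

theorem stmt10 (dA dC : ℕ) :
    ∃ c : ℝ, c < 1 ∧
      ∀ (dB : ℕ) (ψ : Fin dA × Fin dB × Fin dC → ℂ), Normalized ψ → NonNeg ψ →
        rhoAC ψ = rhoA ψ ⊗ₖ rhoC ψ →
        (∑ j ∈ Finset.univ.filter (fun j => 0 < probB ψ j),
            probB ψ j * vnEntropy (rhoAPost ψ j)) ≤
          c * max (vnEntropy (rhoA ψ)) (vnEntropy (rhoC ψ)) := by
  obtain ⟨c, hc, hbound⟩ := exists_entropy_contraction (Fin dA) (Fin dC)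
  refine ⟨c, hc, fun dB ψ hn h hprod => ?_⟩
  have hens := h.isProductEnsemble hn hprod
  have key := hbound _ _ _ hens fun j => h.postMatrix_nonneg j
  rw [Finset.sum_subtype _ (p := fun j => 0 < probB ψ j) (by simp), h.rhoA_eq, h.rhoC_eq,
    vnEntropy_map_ofReal hens.posSemidef_leftMarginal.1,
    vnEntropy_map_ofReal hens.transpose.posSemidef_leftMarginal.1]
  refine le_of_eq_of_le (Finset.sum_congr rfl fun j _ => ?_) key
  rw [h.rhoAPost_eq,
    vnEntropy_map_ofReal (IsProductEnsemble.posSemidef_mul_transpose (postMatrix ψ j)).1]
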